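/- arXiv:math/0203273 — 2 statements merged into one kernel-verified Lean document; each statement's English description precedes it below -/
import Mathlib

section
/- Let K be a field and let C be a small K-linear category which is Wedderburn, i.e. for every object X the Jacobson radical J(End(X)) of End(X) is nilpotent and End(X)/J(End(X)) is a separable K-algebra. If σ and σ′ are two functorial K-linear sections of the projection of C onto its quotient by the radical, then there exists a family (u_X)_{X ∈ C} of endomorphisms u_X : X ⟶ X with u_X − 𝟙_X ∈ rad(X,X) (so each u_X is invertible) such that for all objects X, Y and every f : X ⟶ Y one has σ′(f) = u_X⁻¹ ≫ σ(f) ≫ u_Y. -/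
open CategoryTheory TensorProduct

universe u v

/-- A subset `S` of a (possibly noncommutative) ring is *nilpotent* if there is an `n ≥ 1`
such that every product of `n` elements of `S` vanishes. -/
def IsNilpotentSet {R : Type*} [Ring R] (S : Set R) : Prop :=
  ∃ n : ℕ, 0 < n ∧ ∀ l : List R, (∀ x ∈ l, x ∈ S) → l.length = n → l.prod = 0

/-- A `K`-algebra `B` is *separable* (or absolutely semisimple) if `L ⊗[K] B` is a
semisimple ring for every field extension `L/K`. -/
def IsSeparableKAlgebra (K : Type u) [Field K] (B : Type v) [Ring B] [Algebra K B] : Prop :=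
  ∀ (L : Type u) [Field L] [Algebra K L], IsSemisimpleRing (TensorProduct K L B)

/-- The relation on a ring identifying two elements whose difference lies in the Jacobson
radical (the intersection of the maximal left ideals). -/
def jacRel (A : Type*) [Ring A] : A → A → Prop :=
  fun a b => a - b ∈ Ideal.jacobson (⊥ : Ideal A)

/-- The quotient of a ring by its Jacobson radical (which is a two-sided ideal), realized
as a `RingQuot`. -/
abbrev JacQuot (A : Type*) [Ring A] := RingQuot (jacRel A)

/-- The radical of a preadditive category: a morphism `f : X ⟶ Y` belongs to the radical
iff `𝟙 X - f ≫ g` is invertible (a unit of the endomorphism ring of `X`) for every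
`g : Y ⟶ X`. -/
def catRadical {C : Type*} [Category C] [Preadditive C] (X Y : C) : Set (X ⟶ Y) :=
  {f | ∀ g : Y ⟶ X, IsIso (𝟙 X - f ≫ g)}

/-- `C` is a *Wedderburn* `K`-linear category: for every object `X` the Jacobson radical of
the endomorphism algebra `End X` is nilpotent, and `End X` modulo its Jacobson radical is
a separable `K`-algebra. -/
def IsWedderburnCat (K : Type u) [Field K] (C : Type v) [SmallCategory C] [Preadditive C]
    [CategoryTheory.Linear K C] : Prop :=
  ∀ X : C,
    IsNilpotentSet (Ideal.jacobson (⊥ : Ideal (End X)) : Set (End X)) ∧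
    IsSeparableKAlgebra K (JacQuot (End X))

/-- A functorial `K`-linear section of the projection of `C` onto its quotient by the
radical: a family of `K`-linear maps `σ X Y : (X ⟶ Y) →ₗ[K] (X ⟶ Y)` such that
`σ f - f` is in the radical, `σ` only depends on `f` modulo the radical, `σ` preserves
identities and `σ` is compatible with composition. -/
def IsFunctorialSection (K : Type u) [Field K] {C : Type v} [SmallCategory C] [Preadditive C]
    [CategoryTheory.Linear K C] (σ : ∀ X Y : C, (X ⟶ Y) →ₗ[K] (X ⟶ Y)) : Prop :=
  (∀ (X Y : C) (f : X ⟶ Y), σ X Y f - f ∈ catRadical X Y) ∧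
  (∀ (X Y : C) (f f' : X ⟶ Y), f - f' ∈ catRadical X Y → σ X Y f = σ X Y f') ∧
  (∀ X : C, σ X X (𝟙 X) = 𝟙 X) ∧
  (∀ (X Y Z : C) (f : X ⟶ Y) (g : Y ⟶ Z), σ X Z (f ≫ g) = σ X Y f ≫ σ Y Z g)

section Polynomial

open Polynomial

theorem exists_polynomial_denominator {L A F : Type*} [Field L] [Ring A] [Algebra L A]
    [Field F] [Algebra L F] [Algebra L[X] F] [IsScalarTower L L[X] F] [IsFractionRing L[X] F]
    (z : A ⊗[L] F) :
    ∃ q : L[X], q ≠ 0 ∧ ∃ P : A ⊗[L] L[X],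
      z * (1 ⊗ₜ algebraMap L[X] F q) =
        Algebra.TensorProduct.map (AlgHom.id L A) (IsScalarTower.toAlgHom L L[X] F) P := by
  induction z using TensorProduct.induction_on with
  | zero => exact ⟨1, one_ne_zero, 0, by simp⟩
  | tmul a l =>
    obtain ⟨p, q, hq, rfl⟩ := IsFractionRing.div_surjective (A := L[X]) l
    have hq0 : q ≠ 0 := nonZeroDivisors.ne_zero hq
    have : algebraMap L[X] F q ≠ 0 := by simpa using hq0
    exact ⟨q, hq0, a ⊗ₜ p, by simp [div_mul_cancel₀ _ this]⟩
  | add x y hx hy =>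
    obtain ⟨q, hq, P, hP⟩ := hx
    obtain ⟨r, hr, Q, hQ⟩ := hy
    refine ⟨q * r, mul_ne_zero hq hr, P * (1 ⊗ₜ r) + Q * (1 ⊗ₜ q), ?_⟩
    rw [map_add, map_mul (algebraMap L[X] F), map_mul (Algebra.TensorProduct.map _ _) P,
      map_mul (Algebra.TensorProduct.map _ _) Q, ← hP, ← hQ, add_mul, mul_assoc, mul_assoc]
    simp [mul_comm]

theorem isAlgebraic_of_isSemisimpleRing_fractionRing {L A : Type*} (F : Type*) [Field L] [Ring A]
    [Algebra L A] [Field F] [Algebra L F] [Algebra L[X] F] [IsScalarTower L L[X] F]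
    [IsFractionRing L[X] F] [IsSemisimpleRing (A ⊗[L] F)] : Algebra.IsAlgebraic L A := by
  refine ⟨fun x ↦ ?_⟩
  let j : A ⊗[L] L[X] →ₐ[L] A ⊗[L] F :=
    Algebra.TensorProduct.map (AlgHom.id L A) (IsScalarTower.toAlgHom L L[X] F)
  have hj : Function.Injective j :=
    Module.Flat.lTensor_preserves_injective_linearMap (M := A)
      (IsScalarTower.toAlgHom L L[X] F).toLinearMap
      (IsFractionRing.injective L[X] F)
  let e := polyEquivTensor L A
  let s : A ⊗[L] L[X] := e (X - C x)
  have hs : IsRightRegular s := by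
    intro a b hab
    apply e.symm.injective
    apply (monic_X_sub_C x).isRegular.right
    apply e.injective
    simpa [s] using hab
  have hc (q : L[X]) (w : A ⊗[L] F) : w * (1 ⊗ₜ[L] algebraMap L[X] F q) =
      (1 ⊗ₜ[L] algebraMap L[X] F q) * w := by
    induction w using TensorProduct.induction_on with
    | zero => simp
    | tmul a l => simp [mul_comm]
    | add a b ha hb => rw [add_mul, mul_add, ha, hb]
  have hu : IsUnit (j s) := by
    rw [IsArtinianRing.isUnit_iff_isRightRegular]
    intro z₁ z₂ hz₁₂
    rw [← sub_eq_zero]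
    have hz : (z₁ - z₂) * j s = 0 := by rw [sub_mul]; exact sub_eq_zero.2 hz₁₂
    generalize z₁ - z₂ = z at hz
    obtain ⟨q, hq, P, hP⟩ := exists_polynomial_denominator (L := L) (A := A) z
    have hq' : IsUnit ((1 : A) ⊗ₜ[L] algebraMap L[X] F q) := by
      have : IsUnit (algebraMap L[X] F q) := by simpa using hq
      exact this.map (Algebra.TensorProduct.includeRight : F →ₐ[L] A ⊗[L] F)
    have : P = 0 := by
      apply hs
      apply hj
      simp only [zero_mul]
      rw [map_mul, map_zero]
      change j P * _ = _
      rw [← show _ = j P from hP, mul_assoc, ← hc, ← mul_assoc, hz, zero_mul]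
    rw [this, map_zero] at hP
    exact (hq'.mul_left_eq_zero).1 hP
  obtain ⟨b, hb⟩ := hu.exists_left_inv
  obtain ⟨q, hq, P, hP⟩ := exists_polynomial_denominator (L := L) (A := A) b
  refine ⟨q, hq, ?_⟩
  have hq' : (1 : A) ⊗ₜ[L] q = P * s := by
    apply hj
    rw [map_mul, ← show _ = j P from hP, mul_assoc, ← hc, ← mul_assoc, hb, one_mul]
    simp [j]
  have := congrArg e.symm hq'
  rw [map_mul, AlgEquiv.symm_apply_apply, polyEquivTensor_symm_apply_tmul_eq_smul, one_smul] at this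
  rw [aeval_def, ← Polynomial.eval_map, this, eval_mul_X_sub_C]

end Polynomial

/-- A `K`-algebra has a separability idempotent: an element `e` of `B ⊗[K] B` with product `1`
such that `b e = e b` for all `b`. -/
def HasSeparabilityIdempotent (K B : Type*) [CommRing K] [Ring B] [Algebra K B] : Prop :=
  ∃ e : B ⊗[K] B, LinearMap.mul' K B e = 1 ∧
    ∀ b : B, LinearMap.rTensor B (LinearMap.mulLeft K b) e =
      LinearMap.lTensor B (LinearMap.mulRight K b) e

theorem HasSeparabilityIdempotent.of_algEquiv {K B B' : Type*} [CommRing K] [Ring B] [Algebra K B]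
    [Ring B'] [Algebra K B'] (f : B ≃ₐ[K] B') (h : HasSeparabilityIdempotent K B) :
    HasSeparabilityIdempotent K B' := by
  obtain ⟨e, he, hb⟩ := h
  let Φ := TensorProduct.map f.toLinearMap f.toLinearMap
  have h₁ (z : B ⊗[K] B) : LinearMap.mul' K B' (Φ z) = f (LinearMap.mul' K B z) := by
    induction z using TensorProduct.induction_on with
    | zero => simp
    | tmul a b => simp [Φ]
    | add a b ha hb => simp only [map_add, ha, hb]
  have h₂ (b : B) (z : B ⊗[K] B) : LinearMap.rTensor B' (LinearMap.mulLeft K (f b)) (Φ z) =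
      Φ (LinearMap.rTensor B (LinearMap.mulLeft K b) z) := by
    induction z using TensorProduct.induction_on with
    | zero => simp
    | tmul a b => simp [Φ]
    | add a b ha hb => simp only [map_add, ha, hb]
  have h₃ (b : B) (z : B ⊗[K] B) : LinearMap.lTensor B' (LinearMap.mulRight K (f b)) (Φ z) =
      Φ (LinearMap.lTensor B (LinearMap.mulRight K b) z) := by
    induction z using TensorProduct.induction_on with
    | zero => simp
    | tmul a b => simp [Φ]
    | add a b ha hb => simp only [map_add, ha, hb]
  refine ⟨Φ e, by rw [h₁, he, map_one], fun b ↦ ?_⟩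
  obtain ⟨b, rfl⟩ := f.surjective b
  rw [h₂, h₃, hb]

theorem HasSeparabilityIdempotent.of_baseChange {K L B : Type*} [Field K] [Field L] [Algebra K L]
    [Ring B] [Algebra K B] (h : HasSeparabilityIdempotent L (L ⊗[K] B)) :
    HasSeparabilityIdempotent K B := by
  obtain ⟨e, he, hb⟩ := h
  obtain ⟨π, hπ⟩ := (Algebra.linearMap K L).exists_leftInverse_of_injective
    (LinearMap.ker_eq_bot.2 (algebraMap K L).injective)
  have hπ1 : π 1 = 1 := by simpa using LinearMap.congr_fun hπ 1
  obtain ⟨e, rfl⟩ := (TensorProduct.AlgebraTensorModule.distribBaseChange K L B B).surjective e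
  let D := TensorProduct.AlgebraTensorModule.distribBaseChange K L B B
  let Φ : L ⊗[K] (B ⊗[K] B) →ₗ[K] B ⊗[K] B :=
    (TensorProduct.lid K _).toLinearMap ∘ₗ LinearMap.rTensor _ π
  let Ψ : L ⊗[K] B →ₗ[K] B := (TensorProduct.lid K _).toLinearMap ∘ₗ LinearMap.rTensor _ π
  have h₁ (z : L ⊗[K] (B ⊗[K] B)) : LinearMap.mul' K B (Φ z) =
      Ψ (LinearMap.mul' L _ (D z)) := by
    induction z using TensorProduct.induction_on with
    | zero => simp
    | add a b ha hb => simp only [map_add, ha, hb]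
    | tmul l z =>
      induction z using TensorProduct.induction_on with
      | zero => simp
      | add a b ha hb => simp only [tmul_add, map_add, ha, hb]
      | tmul a b => simp [Φ, Ψ, D]
  have h₂ (b : B) (z : L ⊗[K] (B ⊗[K] B)) : LinearMap.rTensor B (LinearMap.mulLeft K b) (Φ z) =
      Φ (D.symm (LinearMap.rTensor _ (LinearMap.mulLeft L ((1 : L) ⊗ₜ[K] b)) (D z))) := by
    induction z using TensorProduct.induction_on with
    | zero => simp
    | add a b ha hb => simp only [map_add, ha, hb]
    | tmul l z =>
      induction z using TensorProduct.induction_on with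
      | zero => simp
      | add a b ha hb => simp only [tmul_add, map_add, ha, hb]
      | tmul a b => simp [Φ, D]
  have h₃ (b : B) (z : L ⊗[K] (B ⊗[K] B)) : LinearMap.lTensor B (LinearMap.mulRight K b) (Φ z) =
      Φ (D.symm (LinearMap.lTensor _ (LinearMap.mulRight L ((1 : L) ⊗ₜ[K] b)) (D z))) := by
    induction z using TensorProduct.induction_on with
    | zero => simp
    | add a b ha hb => simp only [map_add, ha, hb]
    | tmul l z =>
      induction z using TensorProduct.induction_on with
      | zero => simp
      | add a b ha hb => simp only [tmul_add, map_add, ha, hb]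
      | tmul a b => simp [Φ, D]
  refine ⟨Φ e, ?_, fun b ↦ ?_⟩
  · rw [h₁, he, Algebra.TensorProduct.one_def]
    simp [Ψ, hπ1]
  · rw [h₂, h₃, hb]

theorem hasSeparabilityIdempotent_pi_matrix (L : Type*) [Field L] {ι : Type*} [Fintype ι]
    [DecidableEq ι] (d : ι → ℕ) [∀ i, NeZero (d i)] :
    HasSeparabilityIdempotent L (Π i, Matrix (Fin (d i)) (Fin (d i)) L) := by
  let E (i : ι) (k l : Fin (d i)) : Π i, Matrix (Fin (d i)) (Fin (d i)) L :=
    Pi.single i (Matrix.single k l 1)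
  have hE (i : ι) (j k l m : Fin (d i)) :
      E i j k * E i l m = if k = l then E i j m else 0 := by
    simp only [E, ← Pi.single_mul]
    split_ifs with h
    · simp [h]
    · simp [Matrix.single_mul_single_of_ne _ _ _ _ h]
  have hE' (i i' : ι) (h : i ≠ i') (j k l m) : E i j k * E i' l m = 0 := by
    ext t
    by_cases ht : t = i
    · subst ht; simp [E, Pi.single_eq_of_ne h]
    · simp [E, Pi.single_eq_of_ne ht]
  have hspan : ⊤ ≤ Submodule.span L (Set.range fun x : Σ i, Fin (d i) × Fin (d i) ↦
      E x.1 x.2.1 x.2.2) := by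
    intro b _
    have : b = ∑ i, ∑ k, ∑ l, b i k l • E i k l := by
      conv_lhs => rw [← Finset.univ_sum_single b]
      refine Finset.sum_congr rfl fun i _ ↦ ?_
      conv_lhs => rw [Matrix.matrix_eq_sum_single (b i)]
      have (M : Matrix (Fin (d i)) (Fin (d i)) L) :
          (Pi.single i M : Π i, Matrix (Fin (d i)) (Fin (d i)) L) =
            LinearMap.single L (fun i ↦ Matrix (Fin (d i)) (Fin (d i)) L) i M := rfl
      simp only [E, this, map_sum, ← map_smul, Matrix.smul_single, smul_eq_mul, mul_one]
    rw [this]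
    exact Submodule.sum_mem _ fun i _ ↦ Submodule.sum_mem _ fun k _ ↦ Submodule.sum_mem _ fun l _ ↦
      Submodule.smul_mem _ _ (Submodule.subset_span ⟨⟨i, k, l⟩, rfl⟩)
  refine ⟨∑ i, ∑ j, E i j 0 ⊗ₜ E i 0 j, ?_, fun b ↦ ?_⟩
  · simp only [map_sum, LinearMap.mul'_apply, hE, if_true]
    conv_rhs => rw [← Finset.univ_sum_single (1 : Π i, Matrix (Fin (d i)) (Fin (d i)) L)]
    refine Finset.sum_congr rfl fun i _ ↦ ?_
    ext t a b
    by_cases ht : t = i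
    · subst ht
      simp [E, Matrix.sum_apply, Matrix.single_apply, Matrix.one_apply, Finset.sum_apply, ite_and]
    · simp [E, Finset.sum_apply, Pi.single_eq_of_ne ht]
  · have hb := hspan (Submodule.mem_top (x := b))
    induction hb using Submodule.span_induction with
    | zero => simp
    | add x y _ _ hx hy =>
      have h₁ : LinearMap.mulLeft L (x + y) = LinearMap.mulLeft L x + LinearMap.mulLeft L y :=
        LinearMap.ext fun z ↦ by simp [add_mul]
      have h₂ : LinearMap.mulRight L (x + y) = LinearMap.mulRight L x + LinearMap.mulRight L y :=
        LinearMap.ext fun z ↦ by simp [mul_add]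
      rw [h₁, h₂, LinearMap.rTensor_add, LinearMap.lTensor_add, LinearMap.add_apply,
        LinearMap.add_apply, hx, hy]
    | smul c x _ hx =>
      have h₁ : LinearMap.mulLeft L (c • x) = c • LinearMap.mulLeft L x :=
        LinearMap.ext fun z ↦ by simp
      have h₂ : LinearMap.mulRight L (c • x) = c • LinearMap.mulRight L x :=
        LinearMap.ext fun z ↦ by simp
      rw [h₁, h₂, LinearMap.rTensor_smul, LinearMap.lTensor_smul, LinearMap.smul_apply,
        LinearMap.smul_apply, hx]
    | mem x hx =>
      obtain ⟨⟨i, k, l⟩, rfl⟩ := hx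
      simp only [map_sum, LinearMap.rTensor_tmul, LinearMap.lTensor_tmul, LinearMap.mulLeft_apply,
        LinearMap.mulRight_apply]
      rw [Finset.sum_eq_single i, Finset.sum_eq_single i]
      · simp [hE, ite_tmul, tmul_ite]
      · intro i' _ h
        simp [hE' _ _ h]
      · simp
      · intro i' _ h
        simp [hE' _ _ h.symm]
      · simp

theorem hasSeparabilityIdempotent_of_isAlgClosed (L A : Type*) [Field L] [IsAlgClosed L] [Ring A]
    [Algebra L A] [IsSemisimpleRing A] [Algebra.IsAlgebraic L A] :
    HasSeparabilityIdempotent L A := by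
  obtain ⟨n, D, d, _, _, hd, ⟨e⟩⟩ := IsSemisimpleRing.exists_algEquiv_pi_matrix_divisionRing L A
  have hD (i : Fin n) : Function.Bijective (algebraMap L (D i)) := by
    have : Algebra.IsAlgebraic L (D i) := by
      refine ⟨fun x ↦ ?_⟩
      rw [← isAlgebraic_algHom_iff (Matrix.scalarAlgHom (Fin (d i)) L : D i →ₐ[L] _)
        (fun a b h ↦ by simpa using congrFun (congrFun h 0) 0)]
      have h := (Algebra.IsAlgebraic.isAlgebraic (R := L)
        (e.symm (Pi.single i (Matrix.scalarAlgHom (Fin (d i)) L x)))).algHom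
        ((Pi.evalAlgHom L (fun i ↦ Matrix (Fin (d i)) (Fin (d i)) (D i)) i).comp e.toAlgHom)
      simpa using h
    exact IsAlgClosed.algebraMap_bijective_of_isIntegral
  refine .of_algEquiv ?_ (hasSeparabilityIdempotent_pi_matrix L d)
  exact (AlgEquiv.piCongrRight fun i ↦
    (AlgEquiv.ofBijective (Algebra.ofId L (D i)) (hD i)).mapMatrix).trans e.symm

theorem IsSeparableKAlgebra.isSemisimpleRing {K : Type u} [Field K] {B : Type v} [Ring B]
    [Algebra K B] (h : IsSeparableKAlgebra K B) : IsSemisimpleRing B :=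
  have := h K
  (Algebra.TensorProduct.lid K B).toRingEquiv.isSemisimpleRing

open Polynomial in
theorem IsSeparableKAlgebra.hasSeparabilityIdempotent {K : Type u} [Field K] {B : Type v} [Ring B]
    [Algebra K B] (h : IsSeparableKAlgebra K B) : HasSeparabilityIdempotent K B := by
  let L := AlgebraicClosure K
  let F := FractionRing L[X]
  have : IsSemisimpleRing (L ⊗[K] B) := h L
  have : IsSemisimpleRing (F ⊗[K] B) := h F
  have : IsSemisimpleRing ((L ⊗[K] B) ⊗[L] F) :=
    ((AlgEquiv.ofLinearEquiv (TensorProduct.AlgebraTensorModule.cancelBaseChange K L L F B).symm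
      (by simp [Algebra.TensorProduct.one_def])
      (LinearMap.map_mul_of_map_mul_tmul fun _ _ _ _ ↦ by simp)).trans
      (Algebra.TensorProduct.comm L F (L ⊗[K] B))).toRingEquiv.isSemisimpleRing
  have := isAlgebraic_of_isSemisimpleRing_fractionRing (L := L) (A := L ⊗[K] B) F
  exact .of_baseChange (hasSeparabilityIdempotent_of_isAlgClosed L (L ⊗[K] B))

/-- Two sections of a ring homomorphism onto an algebra with a separability idempotent are
intertwined by an element lying over `1`. -/
theorem HasSeparabilityIdempotent.exists_intertwiner {K A B : Type*} [CommRing K] [Ring A]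
    [Algebra K A] [Ring B] [Algebra K B] (h : HasSeparabilityIdempotent K B) (q : A →ₐ[K] B)
    (s t : B →ₐ[K] A) (hs : ∀ b, q (s b) = b) (ht : ∀ b, q (t b) = b) :
    ∃ v : A, q v = 1 ∧ ∀ b, s b * v = v * t b := by
  obtain ⟨e, he, hb⟩ := h
  let Φ : B ⊗[K] B →ₗ[K] A :=
    LinearMap.mul' K A ∘ₗ TensorProduct.map s.toLinearMap t.toLinearMap
  have h₁ (z : B ⊗[K] B) : q (Φ z) = LinearMap.mul' K B z := by
    induction z using TensorProduct.induction_on with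
    | zero => simp
    | tmul a b => simp [Φ, hs, ht]
    | add a b ha hb => simp only [map_add, ha, hb]
  have h₂ (b : B) (z : B ⊗[K] B) : s b * Φ z = Φ (LinearMap.rTensor B (LinearMap.mulLeft K b) z) := by
    induction z using TensorProduct.induction_on with
    | zero => simp
    | tmul a b => simp [Φ, mul_assoc]
    | add a b ha hb => simp only [map_add, mul_add, ha, hb]
  have h₃ (b : B) (z : B ⊗[K] B) : Φ z * t b = Φ (LinearMap.lTensor B (LinearMap.mulRight K b) z) := by
    induction z using TensorProduct.induction_on with
    | zero => simp
    | tmul a b => simp [Φ, mul_assoc]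
    | add a b ha hb => simp only [map_add, add_mul, ha, hb]
  exact ⟨Φ e, by rw [h₁, he], fun b ↦ by rw [h₂, h₃, hb]⟩

theorem IsSemisimpleRing.exists_identity_of_isTwoSided {R : Type*} [Ring R] [IsSemisimpleRing R]
    (I : Ideal R) (hI : ∀ a ∈ I, ∀ r, a * r ∈ I) :
    ∃ c ∈ I, (∀ a ∈ I, c * a = a) ∧ (∀ a ∈ I, a * c = a) := by
  obtain ⟨e, he, hIe⟩ := IsSemisimpleRing.ideal_eq_span_idempotent I
  let I' : Ideal Rᵐᵒᵖ :=
    { carrier := {x | x.unop ∈ I}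
      add_mem' := fun ha hb ↦ I.add_mem ha hb
      zero_mem' := I.zero_mem
      smul_mem' := fun r x hx ↦ hI _ hx r.unop }
  obtain ⟨e', he', hIe'⟩ := IsSemisimpleRing.ideal_eq_span_idempotent I'
  have heI : e ∈ I := hIe ▸ Ideal.mem_span_singleton_self e
  have heI' : e' ∈ I' := hIe' ▸ Ideal.mem_span_singleton_self e'
  have h₁ (a : R) (ha : a ∈ I) : a * e = a := by
    rw [hIe, Ideal.mem_span_singleton'] at ha
    obtain ⟨r, rfl⟩ := ha
    rw [mul_assoc, he.eq]
  have h₂ (a : R) (ha : a ∈ I) : e'.unop * a = a := by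
    have ha' : MulOpposite.op a ∈ I' := ha
    rw [hIe', Ideal.mem_span_singleton'] at ha'
    obtain ⟨r, hr⟩ := ha'
    have : a = e'.unop * r.unop := congrArg MulOpposite.unop hr.symm
    rw [this, ← mul_assoc, ← MulOpposite.unop_mul, he'.eq]
  have : e = e'.unop := by rw [← h₁ _ heI', h₂ _ heI]
  exact ⟨e, heI, fun a ha ↦ this ▸ h₂ a ha, h₁⟩

theorem mem_jacobson_bot_iff_isUnit {R : Type*} [Ring R] {x : R} :
    x ∈ Ideal.jacobson (⊥ : Ideal R) ↔ ∀ y, IsUnit (1 - y * x) := by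
  constructor
  · intro hx y
    have key (x : R) (hx : x ∈ Ideal.jacobson (⊥ : Ideal R)) : ∃ z : R, z * (1 - x) = 1 := by
      obtain ⟨z, hz⟩ := Ideal.mem_jacobson_iff.1 hx (-1)
      refine ⟨z, ?_⟩
      rw [Ideal.mem_bot, sub_eq_zero] at hz
      rw [mul_neg_one, neg_mul] at hz
      rw [mul_sub, mul_one, ← hz]
      abel
    have hyx := Ideal.mul_mem_left (Ideal.jacobson (⊥ : Ideal R)) y hx
    obtain ⟨z, hz⟩ := key _ hyx
    have hz' : 1 - z = -(z * (y * x)) := by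
      rw [← hz, mul_sub, mul_one]
      abel
    obtain ⟨w, hw⟩ := key (1 - z) (by
      rw [hz']
      exact neg_mem (Ideal.mul_mem_left _ _ hyx))
    rw [sub_sub_cancel] at hw
    refine ⟨⟨1 - y * x, z, ?_, hz⟩, rfl⟩
    rw [← left_inv_eq_right_inv hw hz]
    exact hw
  · intro h
    rw [Ideal.mem_jacobson_iff]
    intro y
    obtain ⟨z, hz⟩ := (h (-y)).exists_left_inv
    refine ⟨z, ?_⟩
    rw [Ideal.mem_bot, sub_eq_zero, ← hz]
    noncomm_ring

section Radical

variable {C : Type*} [Category C] [Preadditive C]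

theorem isIso_id_sub_comp_swap {X Y : C} {f : X ⟶ Y} {g : Y ⟶ X} (h : IsIso (𝟙 X - f ≫ g)) :
    IsIso (𝟙 Y - g ≫ f) := by
  have h₁ := IsIso.hom_inv_id (𝟙 X - f ≫ g)
  have h₂ := IsIso.inv_hom_id (𝟙 X - f ≫ g)
  generalize inv (𝟙 X - f ≫ g) = v at h₁ h₂
  simp only [Preadditive.sub_comp, Preadditive.comp_sub, Category.id_comp, Category.comp_id,
    Category.assoc] at h₁ h₂
  have h₁' : f ≫ g ≫ v ≫ f = (v - 𝟙 X) ≫ f := by rw [← h₁]; simp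
  have h₂' : v ≫ f ≫ g ≫ f = (v - 𝟙 X) ≫ f := by rw [← h₂]; simp
  refine ⟨𝟙 Y + g ≫ v ≫ f, ?_, ?_⟩
  · simp only [Preadditive.sub_comp, Preadditive.comp_add, Category.id_comp, Category.comp_id,
      Category.assoc]
    rw [h₁']
    simp only [Preadditive.sub_comp, Preadditive.comp_sub, Category.id_comp]
    abel
  · simp only [Preadditive.comp_sub, Preadditive.add_comp, Category.id_comp, Category.comp_id,
      Category.assoc]
    rw [h₂']
    simp only [Preadditive.sub_comp, Preadditive.comp_sub, Category.id_comp]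
    abel

theorem catRadical_comp_right {X Y Z : C} {f : X ⟶ Y} (hf : f ∈ catRadical X Y) (h : Y ⟶ Z) :
    f ≫ h ∈ catRadical X Z := fun g ↦ by
  rw [Category.assoc]
  exact hf _

theorem catRadical_comp_left {X Y Z : C} {f : Y ⟶ Z} (h : X ⟶ Y) (hf : f ∈ catRadical Y Z) :
    h ≫ f ∈ catRadical X Z := fun g ↦ by
  rw [Category.assoc]
  apply isIso_id_sub_comp_swap
  rw [Category.assoc]
  exact hf _

theorem catRadical_zero (X Y : C) : (0 : X ⟶ Y) ∈ catRadical X Y := fun g ↦ by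
  rw [Limits.zero_comp, sub_zero]
  infer_instance

theorem catRadical_neg {X Y : C} {f : X ⟶ Y} (hf : f ∈ catRadical X Y) : -f ∈ catRadical X Y := by
  simpa using catRadical_comp_right hf (-𝟙 Y)

theorem catRadical_add {X Y : C} {f f' : X ⟶ Y} (hf : f ∈ catRadical X Y)
    (hf' : f' ∈ catRadical X Y) : f + f' ∈ catRadical X Y := fun g ↦ by
  have := hf g
  have := catRadical_comp_left (inv (𝟙 X - f ≫ g)) hf' g
  have h : 𝟙 X - (f + f') ≫ g =
      (𝟙 X - f ≫ g) ≫ (𝟙 X - (inv (𝟙 X - f ≫ g) ≫ f') ≫ g) := by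
    rw [Preadditive.comp_sub, Category.assoc, IsIso.hom_inv_id_assoc, Category.comp_id,
      Preadditive.add_comp]
    abel
  rw [h]
  infer_instance

theorem catRadical_sub {X Y : C} {f f' : X ⟶ Y} (hf : f ∈ catRadical X Y)
    (hf' : f' ∈ catRadical X Y) : f - f' ∈ catRadical X Y := by
  rw [sub_eq_add_neg]
  exact catRadical_add hf (catRadical_neg hf')

theorem catRadical_sum {X Y : C} {ι : Type*} (s : Finset ι) {f : ι → (X ⟶ Y)}
    (hf : ∀ i ∈ s, f i ∈ catRadical X Y) : ∑ i ∈ s, f i ∈ catRadical X Y :=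
  Finset.sum_induction f (· ∈ catRadical X Y) (fun _ _ ↦ catRadical_add) (catRadical_zero X Y) hf

theorem isIso_of_sub_id_mem_catRadical {X : C} {u : X ⟶ X} (h : u - 𝟙 X ∈ catRadical X X) :
    IsIso u := by
  simpa using catRadical_neg h (𝟙 X)

theorem mem_catRadical_of_comp_left {X Y : C} {f : X ⟶ Y}
    (h : ∀ g : Y ⟶ X, g ≫ f ∈ catRadical Y Y) : f ∈ catRadical X Y := fun g ↦
  isIso_id_sub_comp_swap (by simpa using h g (𝟙 Y))

theorem mem_catRadical_of_comp_right {X Y : C} {f : X ⟶ Y}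
    (h : ∀ g : Y ⟶ X, f ≫ g ∈ catRadical X X) : f ∈ catRadical X Y := fun g ↦ by
  simpa using h g (𝟙 X)

theorem mem_jacobson_bot_iff_mem_catRadical {X : C} (f : End X) :
    f ∈ Ideal.jacobson (⊥ : Ideal (End X)) ↔ f ∈ catRadical X X := by
  rw [mem_jacobson_bot_iff_isUnit]
  exact forall_congr' fun g ↦ isUnit_iff_isIso (1 - g * f)

end Radical

section FunctorialSection

variable {K : Type u} [Field K] {C : Type v} [SmallCategory C] [Preadditive C]
  [CategoryTheory.Linear K C] {σ σ' : ∀ X Y : C, (X ⟶ Y) →ₗ[K] (X ⟶ Y)}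

namespace IsFunctorialSection

theorem sub_mem (hσ : IsFunctorialSection K σ) {X Y : C} (f : X ⟶ Y) :
    σ X Y f - f ∈ catRadical X Y := hσ.1 X Y f

theorem congr (hσ : IsFunctorialSection K σ) {X Y : C} {f f' : X ⟶ Y}
    (h : f - f' ∈ catRadical X Y) : σ X Y f = σ X Y f' := hσ.2.1 X Y f f' h

theorem map_id (hσ : IsFunctorialSection K σ) (X : C) : σ X X (𝟙 X) = 𝟙 X := hσ.2.2.1 X

theorem map_comp (hσ : IsFunctorialSection K σ) {X Y Z : C} (f : X ⟶ Y) (g : Y ⟶ Z) :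
    σ X Z (f ≫ g) = σ X Y f ≫ σ Y Z g := hσ.2.2.2 X Y Z f g

/-- The algebra section of `End X` modulo its radical induced by a functorial section. -/
noncomputable def endSection (hσ : IsFunctorialSection K σ) (X : C) : JacQuot (End X) →ₐ[K] End X :=
  RingQuot.liftAlgHom K ⟨AlgHom.ofLinearMap (A := End X) (B := End X) (σ X X) (hσ.map_id X)
    fun f g ↦ hσ.map_comp g f,
    fun _ _ h ↦ hσ.congr ((mem_jacobson_bot_iff_mem_catRadical _).1 h)⟩

theorem endSection_mk (hσ : IsFunctorialSection K σ) {X : C} (f : End X) :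
    hσ.endSection X (RingQuot.mkAlgHom K (jacRel (End X)) f) = σ X X f :=
  RingQuot.liftAlgHom_mkAlgHom_apply _ _ _ _

theorem mk_eq_mk_iff (hσ : IsFunctorialSection K σ) {X : C} {f g : End X} :
    RingQuot.mkAlgHom K (jacRel (End X)) f = RingQuot.mkAlgHom K (jacRel (End X)) g ↔
      f - g ∈ catRadical X X := by
  constructor
  · intro h
    have h' : σ X X f = σ X X g := by rw [← hσ.endSection_mk, h, hσ.endSection_mk]
    have := catRadical_sub (hσ.sub_mem g) (hσ.sub_mem f)
    rw [h'] at this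
    simpa using this
  · exact fun h ↦ RingQuot.mkAlgHom_rel K ((mem_jacobson_bot_iff_mem_catRadical _).2 h)

theorem mk_endSection (hσ : IsFunctorialSection K σ) {X : C} (b : JacQuot (End X)) :
    RingQuot.mkAlgHom K (jacRel (End X)) (hσ.endSection X b) = b := by
  obtain ⟨f, rfl⟩ := RingQuot.mkAlgHom_surjective K _ b
  rw [endSection_mk]
  exact hσ.mk_eq_mk_iff.2 (hσ.sub_mem (X := X) (Y := X) f)

theorem exists_end_intertwiner (hσ : IsFunctorialSection K σ) (hσ' : IsFunctorialSection K σ')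
    {X : C} (hX : IsSeparableKAlgebra K (JacQuot (End X))) :
    ∃ v : X ⟶ X, v - 𝟙 X ∈ catRadical X X ∧ ∀ f : X ⟶ X, σ X X f ≫ v = v ≫ σ' X X f := by
  obtain ⟨v, hv, h⟩ := hX.hasSeparabilityIdempotent.exists_intertwiner
    (RingQuot.mkAlgHom K (jacRel (End X))) (hσ'.endSection X) (hσ.endSection X)
    hσ'.mk_endSection hσ.mk_endSection
  refine ⟨v, hσ.mk_eq_mk_iff.1 (hv.trans (map_one _).symm), fun f ↦ ?_⟩
  have := h (RingQuot.mkAlgHom K (jacRel (End X)) f)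
  rw [endSection_mk, endSection_mk] at this
  exact this.symm

/-- Endomorphisms of an object `X` factoring through a given class `S` of objects admit, modulo the
radical, an identity which is central and a finite sum of endomorphisms factoring through `S`. -/
theorem exists_sum_comp_identity (hσ : IsFunctorialSection K σ) (X : C)
    (hX : IsSemisimpleRing (JacQuot (End X))) {T : Type*} (o : T → C) :
    ∃ (n : ℕ) (t : Fin n → T) (a : ∀ i, X ⟶ o (t i)) (b : ∀ i, o (t i) ⟶ X),
      (∀ (s : T) (g : X ⟶ o s), (∑ i, a i ≫ b i) ≫ g - g ∈ catRadical X (o s)) ∧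
      (∀ (s : T) (f : o s ⟶ X), f ≫ (∑ i, a i ≫ b i) - f ∈ catRadical (o s) X) ∧
      (∀ h : X ⟶ X, (∑ i, a i ≫ b i) ≫ h - h ≫ (∑ i, a i ≫ b i) ∈ catRadical X X) := by
  let q := RingQuot.mkAlgHom K (jacRel (End X))
  let S : Set (JacQuot (End X)) :=
    {x | ∃ (t : T) (a : X ⟶ o t) (b : o t ⟶ X), x = q (a ≫ b : X ⟶ X)}
  have hS : ∀ x ∈ Ideal.span S, ∀ r, x * r ∈ Ideal.span S := by
    intro x hx r
    obtain ⟨r, rfl⟩ := RingQuot.mkAlgHom_surjective K _ r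
    induction hx using Submodule.span_induction with
    | zero => simp
    | add x y _ _ hx hy => rw [add_mul]; exact add_mem hx hy
    | smul c x _ hx => rw [smul_mul_assoc]; exact Ideal.mul_mem_left _ _ hx
    | mem x hx =>
      obtain ⟨t, a, b, rfl⟩ := hx
      refine Ideal.subset_span ⟨t, r ≫ a, b, ?_⟩
      rw [Category.assoc]
      exact (map_mul q _ _).symm
  obtain ⟨c, hc, hl, hr⟩ := IsSemisimpleRing.exists_identity_of_isTwoSided (Ideal.span S) hS
  obtain ⟨n, r, g, hrg⟩ := Submodule.mem_span_set'.1 hc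
  choose t a b hab using fun i ↦ (g i).2
  choose h hh using fun i ↦ RingQuot.mkAlgHom_surjective K (jacRel (End X)) (r i)
  have hcc : q (∑ i, a i ≫ b i ≫ h i : X ⟶ X) = c := by
    rw [← hrg]
    refine (map_sum q _ _).trans (Finset.sum_congr rfl fun i _ ↦ ?_)
    rw [hab, ← hh, ← Category.assoc]
    exact map_mul q (h i) _
  have hcomp (f g : End X) : q (f ≫ g : X ⟶ X) = q g * q f := map_mul q g f
  refine ⟨n, t, a, fun i ↦ b i ≫ h i, fun s g ↦ ?_, fun s f ↦ ?_, fun f ↦ ?_⟩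
  · refine mem_catRadical_of_comp_right fun f ↦ ?_
    rw [Preadditive.sub_comp, Category.assoc]
    refine hσ.mk_eq_mk_iff.1 ?_
    refine (hcomp _ _).trans ?_
    rw [hcc]
    exact hr _ (Ideal.subset_span ⟨s, g, f, rfl⟩)
  · refine mem_catRadical_of_comp_left fun g ↦ ?_
    rw [Preadditive.comp_sub, ← Category.assoc]
    refine hσ.mk_eq_mk_iff.1 ?_
    refine (hcomp _ _).trans ?_
    rw [hcc]
    exact hl _ (Ideal.subset_span ⟨s, g, f, rfl⟩)
  · refine hσ.mk_eq_mk_iff.1 ?_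
    refine ((hcomp _ _).trans ?_).trans (hcomp _ _).symm
    rw [hcc]
    have h₁ := hl _ (Ideal.mul_mem_left _ (q f) hc)
    have h₂ := hr _ (hS _ hc (q f))
    rw [← h₁, ← mul_assoc, h₂]

/-- A compatible family of conjugating endomorphisms indexed by `T` extends to any further
object. -/
theorem exists_intertwiner_extension (hσ : IsFunctorialSection K σ)
    (hσ' : IsFunctorialSection K σ') {X : C} (hX : IsSeparableKAlgebra K (JacQuot (End X)))
    {T : Type*} (o : T → C) (p : ∀ t, o t ⟶ o t) (hp : ∀ t, p t - 𝟙 (o t) ∈ catRadical _ _)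
    (h : ∀ s t (f : o s ⟶ o t), σ _ _ f ≫ p t = p s ≫ σ' _ _ f) :
    ∃ u : X ⟶ X, u - 𝟙 X ∈ catRadical X X ∧
      (∀ f : X ⟶ X, σ _ _ f ≫ u = u ≫ σ' _ _ f) ∧
      (∀ t (f : X ⟶ o t), σ _ _ f ≫ p t = u ≫ σ' _ _ f) ∧
      (∀ t (f : o t ⟶ X), σ _ _ f ≫ u = p t ≫ σ' _ _ f) := by
  obtain ⟨n, t, a, b, hl, hr, hc⟩ := hσ.exists_sum_comp_identity X hX.isSemisimpleRing o
  obtain ⟨v, hv, hvσ⟩ := hσ.exists_end_intertwiner hσ' hX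
  set c : X ⟶ X := ∑ i, a i ≫ b i with hc_def
  let U : X ⟶ X := ∑ i, σ _ _ (a i) ≫ p (t i) ≫ σ' _ _ (b i)
  have hUin (s) (f : o s ⟶ X) : σ _ _ f ≫ U = p s ≫ σ' _ _ f := by
    rw [← hσ'.congr (hr s f), hc_def]
    simp only [U, Preadditive.comp_sum, map_sum, hσ'.map_comp]
    refine Finset.sum_congr rfl fun i _ ↦ ?_
    rw [← Category.assoc, ← Category.assoc, ← hσ.map_comp, h, Category.assoc, hσ'.map_comp,
      Category.assoc]
  have hUout (s) (f : X ⟶ o s) : U ≫ σ' _ _ f = σ _ _ f ≫ p s := by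
    rw [← hσ.congr (hl s f), hc_def]
    simp only [U, Preadditive.sum_comp, map_sum, hσ.map_comp, Category.assoc]
    refine Finset.sum_congr rfl fun i _ ↦ ?_
    rw [← hσ'.map_comp, ← h, hσ.map_comp, Category.assoc]
  have hUc : U ≫ σ' _ _ c = U := by
    simp only [U, Preadditive.sum_comp, Category.assoc, ← hσ'.map_comp]
    exact Finset.sum_congr rfl fun i _ ↦ by rw [hσ'.congr (hr _ (b i))]
  have hU (f : X ⟶ X) : σ _ _ f ≫ U = U ≫ σ' _ _ f := by
    have h₁ : σ _ _ f ≫ U = U ≫ σ' _ _ (f ≫ c) := by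
      rw [hc_def]
      simp only [Preadditive.comp_sum, map_sum]
      conv_lhs => simp only [U, Preadditive.comp_sum]
      refine Finset.sum_congr rfl fun i _ ↦ ?_
      rw [← Category.assoc f, hσ'.map_comp (f ≫ a i), ← Category.assoc U, hUout, hσ.map_comp]
      simp only [Category.assoc]
    rw [h₁, ← hσ'.congr (hc f), hσ'.map_comp, ← Category.assoc, hUc]
  have hUsub : U - c ∈ catRadical X X := by
    rw [hc_def, ← Finset.sum_sub_distrib]
    refine catRadical_sum _ fun i _ ↦ ?_
    have : σ _ _ (a i) ≫ p (t i) ≫ σ' _ _ (b i) - a i ≫ b i =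
        (σ _ _ (a i) - a i) ≫ p (t i) ≫ σ' _ _ (b i) +
          a i ≫ ((p (t i) - 𝟙 _) ≫ σ' _ _ (b i) + (σ' _ _ (b i) - b i)) := by
      simp only [Preadditive.sub_comp, Preadditive.comp_add, Preadditive.comp_sub, Category.id_comp]
      abel
    rw [this]
    exact catRadical_add (catRadical_comp_right (hσ.sub_mem _) _)
      (catRadical_comp_left _ (catRadical_add (catRadical_comp_right (hp _) _) (hσ'.sub_mem _)))
  let d : X ⟶ X := 𝟙 X - c
  have hd (f : X ⟶ X) : σ' _ _ (d ≫ f) = σ' _ _ (f ≫ d) := hσ'.congr <| by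
    have := catRadical_neg (hc f)
    simpa [d, Preadditive.sub_comp, Preadditive.comp_sub] using this
  have hdl (s) (f : X ⟶ o s) : σ' _ _ d ≫ σ' _ _ f = 0 := by
    rw [← hσ'.map_comp, Preadditive.sub_comp, Category.id_comp, map_sub, hσ'.congr (hl s f),
      sub_self]
  have hdr (s) (f : o s ⟶ X) : σ _ _ f ≫ σ _ _ d = 0 := by
    rw [← hσ.map_comp, Preadditive.comp_sub, Category.comp_id, map_sub, hσ.congr (hr s f),
      sub_self]
  refine ⟨U + v ≫ σ' _ _ d, ?_, fun f ↦ ?_, fun s f ↦ ?_, fun s f ↦ ?_⟩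
  · have : U + v ≫ σ' _ _ d - 𝟙 X =
        (U - c) + ((v - 𝟙 X) ≫ σ' _ _ d + (σ' _ _ d - d)) := by
      simp only [d, Preadditive.sub_comp, Category.id_comp]
      abel
    rw [this]
    exact catRadical_add hUsub
      (catRadical_add (catRadical_comp_right hv _) (hσ'.sub_mem _))
  · rw [Preadditive.comp_add, Preadditive.add_comp, hU, ← Category.assoc, hvσ, Category.assoc,
      Category.assoc, ← hσ'.map_comp, ← hσ'.map_comp, hd]
  · rw [Preadditive.add_comp, hUout, Category.assoc, hdl, Limits.comp_zero, add_zero]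
  · rw [Preadditive.comp_add, hUin, ← hvσ, ← Category.assoc, hdr, Limits.zero_comp, add_zero]

/-- Any two functorial sections are intertwined by a family of endomorphisms lying over the
identities. -/
theorem exists_intertwiner (hσ : IsFunctorialSection K σ) (hσ' : IsFunctorialSection K σ')
    (hC : ∀ X : C, IsSeparableKAlgebra K (JacQuot (End X))) :
    ∃ u : ∀ X : C, X ⟶ X, (∀ X, u X - 𝟙 X ∈ catRadical X X) ∧
      ∀ (X Y : C) (f : X ⟶ Y), σ X Y f ≫ u Y = u X ≫ σ' X Y f := by
  let P : Set (Set (Σ X : C, X ⟶ X)) :=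
    {G | (∀ x ∈ G, x.2 - 𝟙 x.1 ∈ catRadical _ _) ∧
      ∀ x ∈ G, ∀ y ∈ G, ∀ f : x.1 ⟶ y.1, σ _ _ f ≫ y.2 = x.2 ≫ σ' _ _ f}
  obtain ⟨G, hG⟩ := zorn_subset P fun c hcP hc ↦ by
    refine ⟨⋃₀ c, ⟨?_, ?_⟩, fun s hs ↦ Set.subset_sUnion_of_mem hs⟩
    · rintro x ⟨s, hs, hx⟩
      exact (hcP hs).1 x hx
    · rintro x ⟨s, hs, hx⟩ y ⟨t, ht, hy⟩
      obtain hst | hst := hc.total hs ht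
      · exact (hcP ht).2 x (hst hx) y hy
      · exact (hcP hs).2 x hx y (hst hy)
  have hGX (X : C) : ∃ u : X ⟶ X, (⟨X, u⟩ : Σ X : C, X ⟶ X) ∈ G := by
    obtain ⟨u, hu, h, hout, hin⟩ := hσ.exists_intertwiner_extension hσ' (hC X)
      (fun x : G ↦ x.1.1) (fun x ↦ x.1.2) (fun x ↦ hG.prop.1 x.1 x.2)
      (fun x y f ↦ hG.prop.2 x.1 x.2 y.1 y.2 f)
    refine ⟨u, hG.le_of_ge ⟨?_, ?_⟩ (Set.subset_insert ⟨X, u⟩ G) (Set.mem_insert _ _)⟩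
    · rintro x (rfl | hx)
      · exact hu
      · exact hG.prop.1 x hx
    · rintro x (rfl | hx) y (rfl | hy) f
      · exact h f
      · exact hout ⟨y, hy⟩ f
      · exact hin ⟨x, hx⟩ f
      · exact hG.prop.2 x hx y hy f
  choose u hu using hGX
  exact ⟨u, fun X ↦ hG.prop.1 _ (hu X), fun X Y f ↦ hG.prop.2 _ (hu X) _ (hu Y) f⟩

end IsFunctorialSection

end FunctorialSection

/-- **Conjugacy of functorial sections.** If `C` is a small Wedderburn `K`-linear category,
any two functorial `K`-linear sections `σ`, `σ'` of the projection of `C` onto its quotient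
by the radical are conjugate: there is a family of automorphisms `u X : X ≅ X` with
`(u X).hom - 𝟙 X` in the radical (in particular each `u X` is invertible) such that
`σ' f = (u X)⁻¹ ≫ σ f ≫ u Y` for every `f : X ⟶ Y`. -/
theorem functorial_sections_conjugate
    (K : Type u) [Field K] (C : Type v) [SmallCategory C] [Preadditive C]
    [CategoryTheory.Linear K C] [Limits.HasFiniteBiproducts C]
    (hW : IsWedderburnCat K C)
    (σ σ' : ∀ X Y : C, (X ⟶ Y) →ₗ[K] (X ⟶ Y))
    (hσ : IsFunctorialSection K σ) (hσ' : IsFunctorialSection K σ') :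
    ∃ u : ∀ X : C, X ≅ X,
      (∀ X : C, (u X).hom - 𝟙 X ∈ catRadical X X) ∧
      ∀ (X Y : C) (f : X ⟶ Y), σ' X Y f = (u X).inv ≫ σ X Y f ≫ (u Y).hom := by
  obtain ⟨u, hu, h⟩ := hσ.exists_intertwiner hσ' fun X ↦ (hW X).2
  have (X : C) : IsIso (u X) := isIso_of_sub_id_mem_catRadical (hu X)
  refine ⟨fun X ↦ asIso (u X), hu, fun X Y f ↦ ?_⟩
  rw [asIso_inv, asIso_hom, h, IsIso.inv_hom_id_assoc]
end

section
/- Let K be a field, let B and C be small K-linear categories each of which is Wedderburn (for every object X the Jacobson radical J(End(X)) is nilpotent and End(X)/J(End(X)) is a separable K-algebra), and let T : B ⥤ C be an additive K-linear functor which is radicial, i.e. T maps rad_B(X,Y) into rad_C(T X, T Y) for all objects X, Y of B. Let σ_C and σ_B be functorial K-linear sections for C and B respectively. Then there exists a family (u_X)_{X ∈ B} of endomorphisms u_X : T X ⟶ T X with u_X − 𝟙_{T X} ∈ rad_C(T X, T X) (so each u_X is invertible) such that for all objects X, X′ of B and every h : X ⟶ X′ one has σ_C(T(h)) = u_X⁻¹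 ≫ T(σ_B(h)) ≫ u_{X′}. -/
open CategoryTheory TensorProduct

universe u v

open Polynomial

section
variable {k A : Type*} [Field k] [Ring A] [Algebra k A]

/-- The canonical map from polynomials over `A` to the base change of `A` along `k → k(X)`. -/
noncomputable def polyToBaseChange (k A : Type*) [Field k] [Ring A] [Algebra k A] :
    A[X] →ₐ[k] FractionRing k[X] ⊗[k] A :=
  ((Algebra.TensorProduct.map (IsScalarTower.toAlgHom k k[X] (FractionRing k[X]))
    (AlgHom.id k A)).comp (Algebra.TensorProduct.comm k A k[X]).toAlgHom).comp
    (polyEquivTensor k A).toAlgHom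

theorem polyToBaseChange_injective : Function.Injective (polyToBaseChange k A) := by
  have h : Function.Injective (Algebra.TensorProduct.map
      (IsScalarTower.toAlgHom k k[X] (FractionRing k[X])) (AlgHom.id k A)) :=
    Module.Flat.rTensor_preserves_injective_linearMap (M := A)
      (IsScalarTower.toAlgHom k k[X] (FractionRing k[X])).toLinearMap
      (IsFractionRing.injective k[X] (FractionRing k[X]))
  exact h.comp ((Algebra.TensorProduct.comm k A k[X]).injective.comp
    (polyEquivTensor k A).injective)

theorem polyToBaseChange_C_mul_map (a : A) (p : k[X]) :
    polyToBaseChange k A (C a * p.map (algebraMap k A)) =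
      algebraMap k[X] (FractionRing k[X]) p ⊗ₜ a := by
  have h : (polyEquivTensor k A).symm (a ⊗ₜ p) = C a * p.map (algebraMap k A) := by
    rw [polyEquivTensor_symm_apply_tmul_eq_smul, smul_eq_C_mul]
  rw [← h]
  change Algebra.TensorProduct.map _ _ (Algebra.TensorProduct.comm k A k[X]
    (polyEquivTensor k A ((polyEquivTensor k A).symm (a ⊗ₜ p)))) = _
  rw [AlgEquiv.apply_symm_apply]
  simp

theorem polyToBaseChange_map (p : k[X]) :
    polyToBaseChange k A (p.map (algebraMap k A)) =
      algebraMap k[X] (FractionRing k[X]) p ⊗ₜ 1 := by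
  simpa using polyToBaseChange_C_mul_map (1 : A) p

theorem exists_mul_eq_polyToBaseChange (z : FractionRing k[X] ⊗[k] A) :
    ∃ d : k[X], d ≠ 0 ∧ ∃ f : A[X],
      (algebraMap k[X] (FractionRing k[X]) d ⊗ₜ[k] (1 : A)) * z = polyToBaseChange k A f := by
  induction z with
  | zero => exact ⟨1, one_ne_zero, 0, by simp⟩
  | tmul q a =>
    obtain ⟨p, d, hd, rfl⟩ := IsFractionRing.div_surjective (A := k[X]) q
    have hd' := nonZeroDivisors.ne_zero hd
    refine ⟨d, hd', C a * p.map (algebraMap k A), ?_⟩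
    have : algebraMap k[X] (FractionRing k[X]) d ≠ 0 := by simpa using hd'
    rw [polyToBaseChange_C_mul_map, Algebra.TensorProduct.tmul_mul_tmul, one_mul,
      mul_div_cancel₀ _ this]
  | add x y hx hy =>
    obtain ⟨d, hd, f, hf⟩ := hx
    obtain ⟨e, he, g, hg⟩ := hy
    refine ⟨d * e, mul_ne_zero hd he, e.map (algebraMap k A) * f + d.map (algebraMap k A) * g, ?_⟩
    rw [map_add, map_mul, map_mul (polyToBaseChange k A), map_mul (polyToBaseChange k A),
      ← hf, ← hg, polyToBaseChange_map, polyToBaseChange_map, ← mul_assoc, ← mul_assoc, mul_add]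
    simp [mul_comm]

theorem tmul_one_mul_eq_zero {d : k[X]} (hd : d ≠ 0) {z : FractionRing k[X] ⊗[k] A}
    (h : (algebraMap k[X] (FractionRing k[X]) d ⊗ₜ[k] (1 : A)) * z = 0) : z = 0 := by
  have hd' : algebraMap k[X] (FractionRing k[X]) d ≠ 0 := by simpa using hd
  calc z = (((algebraMap k[X] (FractionRing k[X]) d)⁻¹ ⊗ₜ[k] (1 : A)) *
      (algebraMap k[X] (FractionRing k[X]) d ⊗ₜ[k] (1 : A))) * z := by
        rw [Algebra.TensorProduct.tmul_mul_tmul, inv_mul_cancel₀ hd', one_mul,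
          ← Algebra.TensorProduct.one_def, one_mul]
    _ = 0 := by rw [mul_assoc, h, mul_zero]

/-- If the base change of `A` to the rational function field is Artinian, then `A` is integral. -/
theorem isIntegral_of_isArtinianRing_baseChange [IsArtinianRing (FractionRing k[X] ⊗[k] A)] :
    Algebra.IsIntegral k A := by
  refine ⟨fun x ↦ ?_⟩
  set s := polyToBaseChange k A (X - C x) with hs
  have hinj : Function.Injective
      (LinearMap.toSpanSingleton (FractionRing k[X] ⊗[k] A) (FractionRing k[X] ⊗[k] A) s) := by
    rw [injective_iff_map_eq_zero]
    intro z hz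
    rw [LinearMap.toSpanSingleton_apply, smul_eq_mul] at hz
    obtain ⟨d, hd, f, hf⟩ := exists_mul_eq_polyToBaseChange z
    have h0 : polyToBaseChange k A (f * (X - C x)) = 0 := by
      rw [map_mul, ← hf, mul_assoc, ← hs, hz, mul_zero]
    have h1 := polyToBaseChange_injective (h0.trans (map_zero _).symm)
    have h2 : f = 0 := (monic_X_sub_C x).mul_left_eq_zero_iff.1 h1
    exact tmul_one_mul_eq_zero hd (by rw [hf, h2, map_zero])
  obtain ⟨y, hy⟩ := IsArtinian.surjective_of_injective_endomorphism _ hinj 1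
  rw [LinearMap.toSpanSingleton_apply, smul_eq_mul] at hy
  obtain ⟨d, hd, f, hf⟩ := exists_mul_eq_polyToBaseChange y
  have h1 : f * (X - C x) = d.map (algebraMap k A) := by
    apply polyToBaseChange_injective (k := k)
    rw [map_mul, ← hf, mul_assoc, ← hs, hy, mul_one, polyToBaseChange_map]
  have h2 := eval_mul_X_sub_C (p := f) x
  rw [h1, eval_map_algebraMap] at h2
  exact IsAlgebraic.isIntegral (K := k) ⟨d, hd, h2⟩
end

/-- A `K`-algebra has a separability element if the multiplication `A ⊗ A → A` splits as a
map of bimodules. -/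
def HasSeparabilityElement (K A : Type*) [CommRing K] [Ring A] [Algebra K A] : Prop :=
  ∃ e : A ⊗[K] A, LinearMap.mul' K A e = 1 ∧
    ∀ x : A, (LinearMap.mulLeft K x).rTensor A e = (LinearMap.mulRight K x).lTensor A e

namespace HasSeparabilityElement

theorem of_surjective {K A A' : Type*} [CommRing K] [Ring A] [Algebra K A] [Ring A']
    [Algebra K A'] (f : A →ₐ[K] A') (hf : Function.Surjective f)
    (h : HasSeparabilityElement K A) : HasSeparabilityElement K A' := by
  obtain ⟨e, he, hx⟩ := h
  refine ⟨TensorProduct.map f.toLinearMap f.toLinearMap e, ?_, fun y ↦ ?_⟩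
  · have : LinearMap.mul' K A' ∘ₗ TensorProduct.map f.toLinearMap f.toLinearMap =
        f.toLinearMap ∘ₗ LinearMap.mul' K A := by
      ext; simp
    have h' := LinearMap.congr_fun this e
    simpa [he] using h'
  · obtain ⟨x, rfl⟩ := hf y
    have h₁ : (LinearMap.mulLeft K (f x)).rTensor A' ∘ₗ
        TensorProduct.map f.toLinearMap f.toLinearMap =
        TensorProduct.map f.toLinearMap f.toLinearMap ∘ₗ (LinearMap.mulLeft K x).rTensor A := by
      ext; simp
    have h₂ : (LinearMap.mulRight K (f x)).lTensor A' ∘ₗ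
        TensorProduct.map f.toLinearMap f.toLinearMap =
        TensorProduct.map f.toLinearMap f.toLinearMap ∘ₗ (LinearMap.mulRight K x).lTensor A := by
      ext; simp
    have h₁' := LinearMap.congr_fun h₁ e
    have h₂' := LinearMap.congr_fun h₂ e
    simp only [LinearMap.comp_apply] at h₁' h₂'
    rw [h₁', h₂', hx]

theorem pi_matrix (k : Type*) [CommRing k] {ι : Type*} [Fintype ι] [DecidableEq ι] (n : ι → ℕ)
    [∀ i, NeZero (n i)] :
    HasSeparabilityElement k (∀ i, Matrix (Fin (n i)) (Fin (n i)) k) := by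
  let E (i : ι) (p q : Fin (n i)) : ∀ i, Matrix (Fin (n i)) (Fin (n i)) k :=
    Pi.single i (Matrix.single p q 1)
  have hEl (x : ∀ i, Matrix (Fin (n i)) (Fin (n i)) k) (i : ι) (p r : Fin (n i)) :
      x * E i p r = ∑ q, x i q p • E i q r := by
    funext j
    rcases eq_or_ne j i with rfl | h
    · ext a b
      simp [E, Matrix.mul_apply, Matrix.single_apply, Matrix.sum_apply, ite_and]
    · simp [E, h]
  have hEr (x : ∀ i, Matrix (Fin (n i)) (Fin (n i)) k) (i : ι) (p r : Fin (n i)) :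
      E i r p * x = ∑ q, x i p q • E i r q := by
    funext j
    rcases eq_or_ne j i with rfl | h
    · ext a b
      simp [E, Matrix.mul_apply, Matrix.single_apply, Matrix.sum_apply, ite_and]
    · simp [E, h]
  refine ⟨∑ i, ∑ p, E i p 0 ⊗ₜ E i 0 p, ?_, fun x ↦ ?_⟩
  · funext i
    simp only [map_sum, LinearMap.mul'_apply, E, ← Pi.single_mul]
    simp only [Finset.sum_apply]
    rw [Finset.sum_eq_single i (by intro j _ hj; simp [hj.symm]) (by simp)]
    ext a b
    simp [Matrix.single_apply, Matrix.sum_apply, Matrix.one_apply, ite_and]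
  · simp only [map_sum, LinearMap.rTensor_tmul, LinearMap.lTensor_tmul, LinearMap.mulLeft_apply,
      LinearMap.mulRight_apply, hEl, hEr, TensorProduct.sum_tmul, TensorProduct.tmul_sum,
      TensorProduct.smul_tmul', TensorProduct.tmul_smul]
    exact Finset.sum_congr rfl fun i _ ↦ Finset.sum_comm

theorem of_baseChange {K L A : Type*} [Field K] [Field L] [Algebra K L] [Ring A] [Algebra K A]
    (h : HasSeparabilityElement L (L ⊗[K] A)) : HasSeparabilityElement K A := by
  obtain ⟨φ, hφ⟩ := (Algebra.linearMap K L).exists_leftInverse_of_injective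
    (LinearMap.ker_eq_bot.2 (FaithfulSMul.algebraMap_injective K L))
  have hφ1 : φ 1 = 1 := by simpa using LinearMap.congr_fun hφ 1
  obtain ⟨e, he, hx⟩ := h
  let Ψ : (L ⊗[K] A) ⊗[L] (L ⊗[K] A) →ₗ[K] A ⊗[K] A :=
    (TensorProduct.lid K (A ⊗[K] A)).toLinearMap ∘ₗ φ.rTensor (A ⊗[K] A) ∘ₗ
      ((TensorProduct.AlgebraTensorModule.distribBaseChange K L A A).symm.toLinearMap.restrictScalars
        K)
  have hΨ (l l' : L) (a a' : A) : Ψ ((l ⊗ₜ a) ⊗ₜ (l' ⊗ₜ a')) = φ (l' * l) • (a ⊗ₜ a') := by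
    have : (TensorProduct.AlgebraTensorModule.distribBaseChange K L A A).symm
        ((l ⊗ₜ a) ⊗ₜ (l' ⊗ₜ a')) = (l' * l) ⊗ₜ (a ⊗ₜ a') := rfl
    simp [Ψ, this]
  refine ⟨Ψ e, ?_, fun x ↦ ?_⟩
  · have h₁ : ∀ z : (L ⊗[K] A) ⊗[L] (L ⊗[K] A), LinearMap.mul' K A (Ψ z) =
        TensorProduct.lid K A (φ.rTensor A (LinearMap.mul' L (L ⊗[K] A) z)) := by
      intro z
      induction z with
      | zero => simp
      | add x y hx hy => simp only [map_add, hx, hy]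
      | tmul z w =>
        induction z with
        | zero => simp
        | add x y hx hy => simp only [map_add, hx, hy, TensorProduct.add_tmul]
        | tmul l a =>
          induction w with
          | zero => simp
          | add x y hx hy => simp only [map_add, hx, hy, TensorProduct.tmul_add]
          | tmul l' a' => rw [hΨ]; simp [mul_comm]
    rw [h₁, he, Algebra.TensorProduct.one_def]
    simp [hφ1]
  · have h₁ : ∀ z : (L ⊗[K] A) ⊗[L] (L ⊗[K] A),
        (LinearMap.mulLeft K x).rTensor A (Ψ z) =
          Ψ ((LinearMap.mulLeft L ((1 : L) ⊗ₜ[K] x)).rTensor (L ⊗[K] A) z) ∧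
        (LinearMap.mulRight K x).lTensor A (Ψ z) =
          Ψ ((LinearMap.mulRight L ((1 : L) ⊗ₜ[K] x)).lTensor (L ⊗[K] A) z) := by
      intro z
      induction z with
      | zero => simp
      | add x y hx hy => simp only [map_add, hx, hy, and_self]
      | tmul z w =>
        induction z with
        | zero => simp
        | add x y hx hy => simp only [map_add, hx, hy, TensorProduct.add_tmul, and_self]
        | tmul l a =>
          induction w with
          | zero => simp
          | add x y hx hy => simp only [map_add, hx, hy, TensorProduct.tmul_add, and_self]
          | tmul l' a' => simp [hΨ]
    rw [(h₁ e).1, (h₁ e).2, hx]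

theorem of_isAlgClosed {k A : Type*} [Field k] [IsAlgClosed k] [Ring A] [Algebra k A]
    [IsSemisimpleRing A] [Algebra.IsIntegral k A] : HasSeparabilityElement k A := by
  obtain ⟨m, D, n, hD, hDk, hn, ⟨f⟩⟩ :=
    IsSemisimpleRing.exists_algEquiv_pi_matrix_divisionRing k A
  have hA : Algebra.IsIntegral k (∀ i, Matrix (Fin (n i)) (Fin (n i)) (D i)) :=
    Algebra.IsIntegral.of_surjective f.toAlgHom f.surjective
  have hDi (i : Fin m) : Algebra.IsIntegral k (D i) := by
    have := Algebra.IsIntegral.of_surjective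
      (Pi.evalAlgHom k (fun i ↦ Matrix (Fin (n i)) (Fin (n i)) (D i)) i) (Function.surjective_eval i)
    exact Algebra.IsIntegral.of_injective (B := Matrix (Fin (n i)) (Fin (n i)) (D i))
      (Matrix.scalarAlgHom (Fin (n i)) k) (fun _ _ h ↦ Matrix.scalar_inj.1 h)
  let φ (i : Fin m) : k ≃ₐ[k] D i := AlgEquiv.ofBijective (Algebra.ofId k (D i))
    (IsAlgClosed.algebraMap_bijective_of_isIntegral)
  exact of_surjective
    ((AlgEquiv.piCongrRight fun i ↦ (φ i).mapMatrix (m := Fin (n i))).trans f.symm).toAlgHom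
    (AlgEquiv.surjective _) (pi_matrix k n)

end HasSeparabilityElement

/-- An absolutely semisimple algebra has a separability element. -/
theorem IsSeparableKAlgebra.hasSeparabilityElement {K : Type u} [Field K] {A : Type v} [Ring A]
    [Algebra K A] (h : IsSeparableKAlgebra K A) : HasSeparabilityElement K A := by
  let k := AlgebraicClosure K
  let Ω := FractionRing k[X]
  have : IsSemisimpleRing (k ⊗[K] A) := h k
  have : IsSemisimpleRing (Ω ⊗[K] A) := h Ω
  let f : Ω ⊗[K] A →ₐ[K] Ω ⊗[k] (k ⊗[K] A) := Algebra.TensorProduct.lift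
    (Algebra.TensorProduct.includeLeft)
    ((Algebra.TensorProduct.includeRight.restrictScalars K).comp
      Algebra.TensorProduct.includeRight) (fun x y ↦ by simp [Commute, SemiconjBy])
  have hf : Function.Surjective f := by
    rw [← AlgHom.range_eq_top, eq_top_iff]
    intro z _
    induction z with
    | zero => exact zero_mem _
    | add x y hx hy => exact add_mem (hx trivial) (hy trivial)
    | tmul q w =>
      induction w with
      | zero => simp
      | add x y hx hy => rw [TensorProduct.tmul_add]; exact add_mem (hx trivial) (hy trivial)
      | tmul c a =>
        refine ⟨(c • q) ⊗ₜ a, ?_⟩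
        change ((c • q) ⊗ₜ[k] (1 : k ⊗[K] A)) * ((1 : Ω) ⊗ₜ[k] ((1 : k) ⊗ₜ[K] a)) = _
        rw [Algebra.TensorProduct.tmul_mul_tmul, mul_one, one_mul, TensorProduct.smul_tmul,
          TensorProduct.smul_tmul', smul_eq_mul, mul_one]
  have : IsSemisimpleRing (Ω ⊗[k] (k ⊗[K] A)) := f.toRingHom.isSemisimpleRing_of_surjective hf
  have : Algebra.IsIntegral k (k ⊗[K] A) := isIntegral_of_isArtinianRing_baseChange
  exact .of_baseChange (L := k) .of_isAlgClosed

/-- A two-sided ideal of a semisimple ring contains a unit element for itself. -/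
theorem IsSemisimpleRing.exists_unit_of_isTwoSided {R : Type*} [Ring R] [IsSemisimpleRing R]
    (I : Ideal R) [I.IsTwoSided] : ∃ ε ∈ I, ∀ y ∈ I, y * ε = y ∧ ε * y = y := by
  obtain ⟨ε, hε, hI⟩ := IsSemisimpleRing.ideal_eq_span_idempotent I
  let I' : Ideal Rᵐᵒᵖ :=
    { carrier := {x | x.unop ∈ I}
      add_mem' := fun hx hy ↦ I.add_mem hx hy
      zero_mem' := I.zero_mem
      smul_mem' := fun c x hx ↦ I.mul_mem_right c.unop hx }
  obtain ⟨η, hη, hI'⟩ := IsSemisimpleRing.ideal_eq_span_idempotent I'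
  have hεI : ε ∈ I := hI ▸ Ideal.mem_span_singleton_self ε
  have hηI : η.unop ∈ I := show η ∈ I' from hI' ▸ Ideal.mem_span_singleton_self η
  have h₁ : ∀ y ∈ I, y * ε = y := fun y hy ↦ by
    rw [hI] at hy
    obtain ⟨c, rfl⟩ := Ideal.mem_span_singleton'.1 hy
    rw [mul_assoc, hε.eq]
  have h₂ : ∀ y ∈ I, η.unop * y = y := fun y hy ↦ by
    have hy' : MulOpposite.op y ∈ I' := hy
    rw [hI'] at hy'
    obtain ⟨c, hc⟩ := Ideal.mem_span_singleton'.1 hy'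
    have hc' : y = η.unop * c.unop := by rw [← MulOpposite.unop_mul, hc, MulOpposite.unop_op]
    rw [hc', ← mul_assoc, ← MulOpposite.unop_mul, hη.eq]
  have h : η.unop = ε := by rw [← h₁ _ hηI, h₂ _ hεI]
  exact ⟨ε, hεI, fun y hy ↦ ⟨h₁ y hy, h ▸ h₂ y hy⟩⟩

section SemisimpleCategory

variable {D : Type*} [Category D] [Preadditive D]

theorem eq_zero_of_forall_comp_eq_zero
    (hrad : ∀ (X Y : D) (f : X ⟶ Y), f ∈ catRadical X Y → f = 0) {X Y : D} {f : X ⟶ Y}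
    (h : ∀ g : Y ⟶ X, f ≫ g = 0) : f = 0 :=
  hrad X Y f fun g ↦ by rw [h, sub_zero]; infer_instance

theorem eq_zero_of_forall_comp_eq_zero'
    (hrad : ∀ (X Y : D) (f : X ⟶ Y), f ∈ catRadical X Y → f = 0) {X Y : D} {f : X ⟶ Y}
    (h : ∀ g : Y ⟶ X, g ≫ f = 0) : f = 0 := by
  refine hrad X Y f fun g ↦ ⟨𝟙 X + f ≫ g, ?_, ?_⟩ <;>
  · have : f ≫ g ≫ f ≫ g = 0 := by rw [reassoc_of% (h g), Limits.zero_comp, Limits.comp_zero]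
    simp [this]

/-- In a semisimple category, the identity of `X` is, up to maps factoring through a given class of
objects, a central endomorphism annihilated by all morphisms from and to that class. -/
theorem exists_central_orthogonal (hss : ∀ X : D, IsSemisimpleRing (End X))
    (hrad : ∀ (X Y : D) (f : X ⟶ Y), f ∈ catRadical X Y → f = 0) (P : D → Prop) (X : D) :
    ∃ δ : X ⟶ X, (∀ x : X ⟶ X, x ≫ δ = δ ≫ x) ∧
      (∀ U, P U → ∀ h : X ⟶ U, δ ≫ h = 0) ∧ (∀ U, P U → ∀ h : U ⟶ X, h ≫ δ = 0) ∧
      𝟙 X - δ ∈ AddSubgroup.closure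
        {f : X ⟶ X | ∃ (U : D) (_ : P U) (p : X ⟶ U) (i : U ⟶ X), f = p ≫ i} := by
  set S := {f : X ⟶ X | ∃ (U : D) (_ : P U) (p : X ⟶ U) (i : U ⟶ X), f = p ≫ i} with hS
  have hl (c x : X ⟶ X) (hx : x ∈ AddSubgroup.closure S) : x ≫ c ∈ AddSubgroup.closure S := by
    induction hx using AddSubgroup.closure_induction with
    | mem x hx =>
      obtain ⟨U, hU, p, i, rfl⟩ := hx
      exact AddSubgroup.subset_closure ⟨U, hU, p, i ≫ c, by simp⟩
    | zero => simp
    | add x y _ _ hx hy => rw [Preadditive.add_comp]; exact add_mem hx hy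
    | neg x _ hx => rw [Preadditive.neg_comp]; exact neg_mem hx
  have hr (c x : X ⟶ X) (hx : x ∈ AddSubgroup.closure S) : c ≫ x ∈ AddSubgroup.closure S := by
    induction hx using AddSubgroup.closure_induction with
    | mem x hx =>
      obtain ⟨U, hU, p, i, rfl⟩ := hx
      exact AddSubgroup.subset_closure ⟨U, hU, c ≫ p, i, by simp⟩
    | zero => simp
    | add x y _ _ hx hy => rw [Preadditive.comp_add]; exact add_mem hx hy
    | neg x _ hx => rw [Preadditive.comp_neg]; exact neg_mem hx
  let I : Ideal (End X) :=
    { carrier := {x | (x : X ⟶ X) ∈ AddSubgroup.closure S}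
      add_mem' := fun hx hy ↦ (AddSubgroup.closure S).add_mem hx hy
      zero_mem' := (AddSubgroup.closure S).zero_mem
      smul_mem' := fun c x hx ↦ hl c x hx }
  have : I.IsTwoSided := ⟨fun c hx ↦ hr c _ hx⟩
  have := hss X
  obtain ⟨(ε : X ⟶ X), hε, hI⟩ := IsSemisimpleRing.exists_unit_of_isTwoSided I
  replace hε : ε ∈ AddSubgroup.closure S := hε
  replace hI : ∀ y : X ⟶ X, y ∈ AddSubgroup.closure S → ε ≫ y = y ∧ y ≫ ε = y := hI
  have hSI {U : D} (hU : P U) (p : X ⟶ U) (i : U ⟶ X) : p ≫ i ∈ AddSubgroup.closure S :=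
    AddSubgroup.subset_closure ⟨U, hU, p, i, rfl⟩
  refine ⟨𝟙 X - ε, fun x ↦ ?_, fun U hU h ↦ ?_, fun U hU h ↦ ?_, ?_⟩
  · have h₁ := (hI _ (hr x ε hε)).1
    have h₂ := (hI _ (hl x ε hε)).2
    rw [Category.assoc] at h₂
    rw [Preadditive.comp_sub, Preadditive.sub_comp, Category.comp_id, Category.id_comp, ← h₁, h₂]
  · refine eq_zero_of_forall_comp_eq_zero hrad fun g ↦ ?_
    simp [(hI _ (hSI hU h g)).1]
  · refine eq_zero_of_forall_comp_eq_zero' hrad fun g ↦ ?_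
    have := (hI _ (hSI hU g h)).2
    rw [Category.assoc] at this
    simp [this]
  · rwa [sub_sub_cancel]

/-- A semisimple category has a family of pairwise orthogonal central endomorphisms which generate
all the identities. -/
theorem exists_orthogonal_generating_family (hss : ∀ X : D, IsSemisimpleRing (End X))
    (hrad : ∀ (X Y : D) (f : X ⟶ Y), f ∈ catRadical X Y → f = 0) :
    ∃ δ : ∀ X : D, X ⟶ X, (∀ (X : D) (x : X ⟶ X), x ≫ δ X = δ X ≫ x) ∧
      (∀ (X Y : D) (h : X ⟶ Y), X ≠ Y → δ X ≫ h ≫ δ Y = 0) ∧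
      ∀ X : D, 𝟙 X ∈ AddSubgroup.closure
        {f : X ⟶ X | ∃ (U : D) (p : X ⟶ U) (i : U ⟶ X), f = p ≫ δ U ≫ i} := by
  choose δ hc hfrom hto hgen using fun X : D ↦
    exists_central_orthogonal hss hrad (fun U ↦ WellOrderingRel U X) X
  refine ⟨δ, hc, fun X Y h hXY ↦ ?_, fun X ↦ ?_⟩
  · rcases trichotomous_of WellOrderingRel X Y with hlt | rfl | hlt
    · rw [hto Y X hlt, Limits.comp_zero]
    · exact absurd rfl hXY
    · rw [reassoc_of% hfrom X Y hlt, Limits.zero_comp]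
  · induction X using (IsWellFounded.wf (r := WellOrderingRel (α := D))).induction with
    | _ X ih =>
    set M := AddSubgroup.closure
      {f : X ⟶ X | ∃ (U : D) (p : X ⟶ U) (i : U ⟶ X), f = p ≫ δ U ≫ i}
    have hle : AddSubgroup.closure {f : X ⟶ X | ∃ (U : D) (_ : WellOrderingRel U X)
        (p : X ⟶ U) (i : U ⟶ X), f = p ≫ i} ≤ M := by
      rw [AddSubgroup.closure_le]
      rintro _ ⟨U, hU, p, i, rfl⟩
      have key (m : U ⟶ U) (hm : m ∈ AddSubgroup.closure
          {f : U ⟶ U | ∃ (V : D) (p : U ⟶ V) (i : V ⟶ U), f = p ≫ δ V ≫ i}) :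
          p ≫ m ≫ i ∈ M := by
        induction hm using AddSubgroup.closure_induction with
        | mem m hm =>
          obtain ⟨V, q, j, rfl⟩ := hm
          exact AddSubgroup.subset_closure ⟨V, p ≫ q, j ≫ i, by simp⟩
        | zero => simp
        | add x y _ _ hx hy =>
          rw [Preadditive.add_comp, Preadditive.comp_add]; exact add_mem hx hy
        | neg x _ hx => rw [Preadditive.neg_comp, Preadditive.comp_neg]; exact neg_mem hx
      simpa using key _ (ih U hU)
    rw [← sub_add_cancel (𝟙 X) (δ X)]
    exact add_mem (hle (hgen X)) (AddSubgroup.subset_closure ⟨X, 𝟙 X, 𝟙 X, by simp⟩)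

end SemisimpleCategory

/-- Two linear functors out of a separable semisimple category that agree after applying a
multiplicative linear operator `σ` are related by a natural transformation sent to the identity
by `σ`. -/
theorem exists_natural_of_congruent {K D C : Type*} [Field K] [Category D] [Preadditive D]
    [CategoryTheory.Linear K D] [Category C] [Preadditive C] [CategoryTheory.Linear K C]
    (hss : ∀ X : D, IsSemisimpleRing (End X))
    (hrad : ∀ (X Y : D) (f : X ⟶ Y), f ∈ catRadical X Y → f = 0)
    (hsep : ∀ X : D, HasSeparabilityElement K (End X))
    (σ : ∀ X Y : C, (X ⟶ Y) →ₗ[K] (X ⟶ Y)) (hσ1 : ∀ X, σ X X (𝟙 X) = 𝟙 X)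
    (hσ : ∀ (X Y Z : C) (f : X ⟶ Y) (g : Y ⟶ Z), σ X Z (f ≫ g) = σ X Y f ≫ σ Y Z g)
    (t : D → C) (F G : ∀ X Y : D, (X ⟶ Y) →ₗ[K] (t X ⟶ t Y))
    (hF1 : ∀ X, F X X (𝟙 X) = 𝟙 (t X)) (hG1 : ∀ X, G X X (𝟙 X) = 𝟙 (t X))
    (hF : ∀ (X Y Z : D) (f : X ⟶ Y) (g : Y ⟶ Z), F X Z (f ≫ g) = F X Y f ≫ F Y Z g)
    (hG : ∀ (X Y Z : D) (f : X ⟶ Y) (g : Y ⟶ Z), G X Z (f ≫ g) = G X Y f ≫ G Y Z g)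
    (hFG : ∀ (X Y : D) (f : X ⟶ Y), σ _ _ (F X Y f) = σ _ _ (G X Y f)) :
    ∃ u : ∀ X : D, t X ⟶ t X, (∀ X, σ _ _ (u X) = 𝟙 (t X)) ∧
      ∀ (X Y : D) (h : X ⟶ Y), G X Y h ≫ u Y = u X ≫ F X Y h := by
  obtain ⟨δ, hc, horth, hgen⟩ := exists_orthogonal_generating_family hss hrad
  have hw (X : D) : ∃ w : t X ⟶ t X, σ _ _ w = 𝟙 (t X) ∧
      ∀ x : X ⟶ X, G X X x ≫ w = w ≫ F X X x := by
    obtain ⟨e, he, hx⟩ := hsep X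
    let Λ : End X ⊗[K] End X →ₗ[K] (t X ⟶ t X) := TensorProduct.lift
      (LinearMap.mk₂ K (fun a b : End X ↦ G X X b ≫ F X X a)
        (fun a b c ↦ by rw [map_add, Preadditive.comp_add])
        (fun r a b ↦ by rw [map_smul, Linear.comp_smul])
        (fun a b c ↦ by rw [map_add, Preadditive.add_comp])
        (fun r a b ↦ by rw [map_smul, Linear.smul_comp]))
    have hΛ (a b : End X) : Λ (a ⊗ₜ b) = G X X b ≫ F X X a := rfl
    refine ⟨Λ e, ?_, fun x ↦ ?_⟩
    · have h (z : End X ⊗[K] End X) :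
          σ _ _ (Λ z) = σ _ _ (F X X (LinearMap.mul' K (End X) z)) := by
        induction z with
        | zero => simp
        | add x y hx hy => rw [map_add, map_add, hx, hy, map_add, map_add, map_add]
        | tmul a b => rw [hΛ, hσ, ← hFG, ← hσ, ← hF]; rfl
      rw [h, he]
      exact (congrArg _ (hF1 X)).trans (hσ1 _)
    · have h₁ (z : End X ⊗[K] End X) :
          Λ z ≫ F X X x = Λ ((LinearMap.mulLeft K (show End X from x)).rTensor (End X) z) := by
        induction z with
        | zero => simp
        | add x y hx hy => simp only [map_add, Preadditive.add_comp, hx, hy]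
        | tmul a b =>
          rw [hΛ, Category.assoc, ← hF]; rfl
      have h₂ (z : End X ⊗[K] End X) :
          G X X x ≫ Λ z = Λ ((LinearMap.mulRight K (show End X from x)).lTensor (End X) z) := by
        induction z with
        | zero => simp
        | add x y hx hy => simp only [map_add, Preadditive.comp_add, hx, hy]
        | tmul a b =>
          rw [hΛ, ← Category.assoc, ← hG]; rfl
      rw [h₁, h₂, hx]
  choose w hw1 hwn using hw
  have hv (U U' : D) (k : U ⟶ U') :
      G U U' (δ U ≫ k) ≫ G U' U' (δ U') ≫ w U' = (G U U (δ U) ≫ w U) ≫ F U U' (k ≫ δ U') := by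
    rw [← Category.assoc, ← hG, hwn U, Category.assoc (w U), ← hF, Category.assoc]
    rcases eq_or_ne U U' with rfl | hne
    · exact hwn U _
    · rw [horth U U' k hne, map_zero, map_zero, Limits.zero_comp, Limits.comp_zero]
  have hu (X : D) (m : X ⟶ X) (hm : m ∈ AddSubgroup.closure
      {f : X ⟶ X | ∃ (U : D) (p : X ⟶ U) (i : U ⟶ X), f = p ≫ δ U ≫ i}) :
      ∃ u : t X ⟶ t X, σ _ _ u = σ _ _ (F X X m) ∧ ∀ (U : D) (c : U ⟶ X),
        G U X (δ U ≫ c) ≫ u = (G U U (δ U) ≫ w U) ≫ F U X (c ≫ m) := by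
    induction hm using AddSubgroup.closure_induction with
    | mem m hm =>
      obtain ⟨U, p, i, rfl⟩ := hm
      refine ⟨G X U p ≫ (G U U (δ U) ≫ w U) ≫ F U X i, ?_, fun U' c ↦ ?_⟩
      · simp only [hσ, hF, hw1, ← hFG, Category.comp_id]
      · calc _ = (G U' U (δ U' ≫ c ≫ p) ≫ G U U (δ U) ≫ w U) ≫ F U X i := by
              simp only [hG, Category.assoc]
          _ = _ := by rw [hv]; simp only [hF, Category.assoc]
    | zero => exact ⟨0, by simp, by simp⟩
    | add x y _ _ hx hy =>
      obtain ⟨u, hu1, hu⟩ := hx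
      obtain ⟨u', hu1', hu'⟩ := hy
      exact ⟨u + u', by simp [hu1, hu1'], fun U c ↦ by
        simp only [Preadditive.comp_add, map_add, hu, hu']⟩
    | neg x _ hx =>
      obtain ⟨u, hu1, hu⟩ := hx
      exact ⟨-u, by simp [hu1], fun U c ↦ by simp only [Preadditive.comp_neg, map_neg, hu]⟩
  choose u hu1 hu using fun X ↦ hu X (𝟙 X) (hgen X)
  refine ⟨u, fun X ↦ by rw [hu1, hF1, hσ1], fun X Y h ↦ ?_⟩
  have key (m : X ⟶ X) (hm : m ∈ AddSubgroup.closure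
      {f : X ⟶ X | ∃ (U : D) (p : X ⟶ U) (i : U ⟶ X), f = p ≫ δ U ≫ i}) :
      G X X m ≫ G X Y h ≫ u Y = G X X m ≫ u X ≫ F X Y h := by
    induction hm using AddSubgroup.closure_induction with
    | mem m hm =>
      obtain ⟨U, p, i, rfl⟩ := hm
      have h₁ := hu Y U (i ≫ h)
      have h₂ := hu X U i
      rw [Category.comp_id] at h₁ h₂
      calc _ = G X U p ≫ G U Y (δ U ≫ i ≫ h) ≫ u Y := by simp only [hG, Category.assoc]
        _ = G X U p ≫ (G U X (δ U ≫ i) ≫ u X) ≫ F X Y h := by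
          rw [h₁, h₂]; simp only [hF, Category.assoc]
        _ = _ := by simp only [hG, Category.assoc]
    | zero => simp
    | add x y _ _ hx hy => simp only [map_add, Preadditive.add_comp, hx, hy]
    | neg x _ hx => simp only [map_neg, Preadditive.neg_comp, hx]
  simpa [hG1] using key _ (hgen X)

theorem neg_mem_catRadical {C : Type*} [Category C] [Preadditive C] {X Y : C} {f : X ⟶ Y}
    (hf : f ∈ catRadical X Y) : -f ∈ catRadical X Y := fun g ↦ by
  simpa using hf (-g)

theorem jacobson_bot_subset_catRadical {C : Type*} [Category C] [Preadditive C] {X : C}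
    {f : End X} (hf : f ∈ Ideal.jacobson (⊥ : Ideal (End X))) :
    (f : X ⟶ X) ∈ catRadical X X := by
  have hleft (y : End X) (hy : y ∈ Ideal.jacobson (⊥ : Ideal (End X))) :
      ∃ z, z * (1 - y) = 1 := by
    obtain ⟨z, hz⟩ := Ideal.mem_jacobson_iff.1 hy (-1)
    refine ⟨z, ?_⟩
    rw [Ideal.mem_bot, sub_eq_zero] at hz
    calc z * (1 - y) = z * -1 * y + z := by noncomm_ring
      _ = 1 := hz
  intro g
  let g' : End X := g
  have hy : g' * f ∈ Ideal.jacobson (⊥ : Ideal (End X)) := Ideal.mul_mem_left _ _ hf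
  obtain ⟨z, hz⟩ := hleft _ hy
  obtain ⟨z', hz'⟩ := hleft (-(z * (g' * f))) (neg_mem (Ideal.mul_mem_left _ _ hy))
  have hz1 : z = 1 - -(z * (g' * f)) := by
    rw [mul_sub, mul_one, sub_eq_iff_eq_add] at hz
    rw [sub_neg_eq_add, ← hz]
  rw [← hz1] at hz'
  have : z' = 1 - g' * f := by
    calc z' = z' * (z * (1 - g' * f)) := by rw [hz, mul_one]
      _ = 1 - g' * f := by rw [← mul_assoc, hz', one_mul]
  rw [this] at hz'
  exact ⟨z, hz, hz'⟩

namespace IsFunctorialSection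

variable {K : Type u} [Field K] {B : Type v} [SmallCategory B] [Preadditive B]
  [CategoryTheory.Linear K B] {σ : ∀ X Y : B, (X ⟶ Y) →ₗ[K] (X ⟶ Y)}

theorem map_eq_zero_iff (hσ : IsFunctorialSection K σ) {X Y : B} {f : X ⟶ Y} :
    σ X Y f = 0 ↔ f ∈ catRadical X Y := by
  refine ⟨fun h ↦ ?_, fun h ↦ ?_⟩
  · have := neg_mem_catRadical (hσ.1 X Y f)
    rwa [h, zero_sub, neg_neg] at this
  · have := hσ.2.1 X Y f 0 (by rwa [sub_zero])
    rwa [map_zero] at this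

theorem map_map (hσ : IsFunctorialSection K σ) {X Y : B} (f : X ⟶ Y) :
    σ X Y (σ X Y f) = σ X Y f := hσ.2.1 _ _ _ _ (hσ.1 X Y f)

theorem isIso_of_map_eq_id (hσ : IsFunctorialSection K σ) {X : B} {f : X ⟶ X}
    (hf : σ X X f = 𝟙 X) : IsIso f := by
  have h : 𝟙 X - f ∈ catRadical X X := by
    rw [← hσ.map_eq_zero_iff, map_sub, hσ.2.2.1, hf, sub_self]
  simpa using h (𝟙 X)

theorem isIso_of_isIso_map (hσ : IsFunctorialSection K σ) {X : B} {f g : X ⟶ X}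
    (hfg : σ X X f ≫ σ X X g = 𝟙 X) (hgf : σ X X g ≫ σ X X f = 𝟙 X) : IsIso f := by
  have h₁ : IsIso (f ≫ g) := hσ.isIso_of_map_eq_id (by rw [hσ.2.2.2, hfg])
  have h₂ : IsIso (g ≫ f) := hσ.isIso_of_map_eq_id (by rw [hσ.2.2.2, hgf])
  have : IsSplitEpi f := ⟨⟨⟨inv (g ≫ f) ≫ g, by simp⟩⟩⟩
  have : Mono f := mono_of_mono f g
  exact isIso_of_mono_of_isSplitEpi f

/-- The category with the objects of `B`, whose morphisms are those in the image of a functorial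
section. It is isomorphic to the quotient of `B` by its radical. -/
structure ImageCategory (_ : IsFunctorialSection K σ) where
  /-- The underlying object. -/
  of : B

variable (hσ : IsFunctorialSection K σ)

instance : SmallCategory hσ.ImageCategory where
  Hom X Y := LinearMap.range (σ X.of Y.of)
  id X := ⟨𝟙 X.of, 𝟙 X.of, hσ.2.2.1 X.of⟩
  comp f g := ⟨f.1 ≫ g.1, by
    obtain ⟨_, f, rfl⟩ := f
    obtain ⟨_, g, rfl⟩ := g
    exact ⟨f ≫ g, hσ.2.2.2 _ _ _ f g⟩⟩
  id_comp f := Subtype.ext (Category.id_comp f.1)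
  comp_id f := Subtype.ext (Category.comp_id f.1)
  assoc f g h := Subtype.ext (Category.assoc f.1 g.1 h.1)

instance : Preadditive hσ.ImageCategory where
  homGroup X Y := inferInstanceAs (AddCommGroup (LinearMap.range (σ X.of Y.of)))
  add_comp _ _ _ f f' g := Subtype.ext (Preadditive.add_comp _ _ _ f.1 f'.1 g.1)
  comp_add _ _ _ f g g' := Subtype.ext (Preadditive.comp_add _ _ _ f.1 g.1 g'.1)

instance : CategoryTheory.Linear K hσ.ImageCategory where
  homModule X Y := inferInstanceAs (Module K (LinearMap.range (σ X.of Y.of)))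
  smul_comp _ _ _ r f g := Subtype.ext (Linear.smul_comp _ _ _ r f.1 g.1)
  comp_smul _ _ _ f r g := Subtype.ext (Linear.comp_smul _ _ _ f.1 r g.1)

namespace ImageCategory

/-- The inclusion on morphisms of the image of a functorial section. -/
def incl (X Y : hσ.ImageCategory) : (X ⟶ Y) →ₗ[K] (X.of ⟶ Y.of) :=
  (LinearMap.range (σ X.of Y.of)).subtype

/-- The projection on morphisms to the image of a functorial section. -/
def proj (X Y : hσ.ImageCategory) : (X.of ⟶ Y.of) →ₗ[K] (X ⟶ Y) :=
  (σ X.of Y.of).rangeRestrict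

theorem proj_surjective (X Y : hσ.ImageCategory) : Function.Surjective (proj hσ X Y) :=
  (σ X.of Y.of).surjective_rangeRestrict

theorem incl_injective (X Y : hσ.ImageCategory) : Function.Injective (incl hσ X Y) :=
  Subtype.val_injective

theorem map_incl {X Y : hσ.ImageCategory} (f : X ⟶ Y) :
    σ X.of Y.of (incl hσ X Y f) = incl hσ X Y f := by
  obtain ⟨f, rfl⟩ := proj_surjective hσ X Y f
  exact hσ.map_map f

/-- The projection on endomorphism algebras to the image of a functorial section. -/
def projEnd (X : hσ.ImageCategory) : End X.of →ₐ[K] End X :=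
  AlgHom.ofLinearMap (proj hσ X X) (Subtype.ext (hσ.2.2.1 X.of))
    fun f g ↦ Subtype.ext (hσ.2.2.2 X.of X.of X.of g f)

theorem exists_surjective_jacQuot (X : hσ.ImageCategory) :
    ∃ f : JacQuot (End X.of) →ₐ[K] End X, Function.Surjective f := by
  refine ⟨RingQuot.liftAlgHom K ⟨projEnd hσ X, fun {a b} hab ↦ Subtype.ext ?_⟩, fun y ↦ ?_⟩
  · exact hσ.2.1 X.of X.of a b (jacobson_bot_subset_catRadical hab)
  · obtain ⟨y, rfl⟩ := proj_surjective hσ X X y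
    exact ⟨RingQuot.mkAlgHom K (jacRel (End X.of)) y, RingQuot.liftAlgHom_mkAlgHom_apply ..⟩

theorem hasSeparabilityElement (hB : IsWedderburnCat K B) (X : hσ.ImageCategory) :
    HasSeparabilityElement K (End X) := by
  obtain ⟨f, hf⟩ := exists_surjective_jacQuot hσ X
  exact (hB X.of).2.hasSeparabilityElement.of_surjective f hf

theorem isSemisimpleRing_end (hB : IsWedderburnCat K B) (X : hσ.ImageCategory) :
    IsSemisimpleRing (End X) := by
  obtain ⟨f, hf⟩ := exists_surjective_jacQuot hσ X
  have := (hB X.of).2 K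
  have := (Algebra.TensorProduct.lid K (JacQuot (End X.of))).toRingEquiv.isSemisimpleRing
  exact f.toRingHom.isSemisimpleRing_of_surjective hf

theorem eq_zero_of_mem_catRadical (X Y : hσ.ImageCategory) (f : X ⟶ Y) (hf : f ∈ catRadical X Y) :
    f = 0 := by
  apply incl_injective hσ
  rw [map_zero, ← map_incl, hσ.map_eq_zero_iff]
  intro g
  obtain ⟨y, hy₁, hy₂⟩ := hf (proj hσ Y X g)
  have h : σ X.of X.of (𝟙 _ - incl hσ X Y f ≫ g) =
      incl hσ X X (𝟙 X - f ≫ proj hσ Y X g) := by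
    rw [map_sub, hσ.2.2.2, hσ.2.2.1, map_incl, map_sub]
    rfl
  refine hσ.isIso_of_isIso_map (g := incl hσ X X y) ?_ ?_
  · rw [h, map_incl]
    exact congrArg (incl hσ X X) hy₁
  · rw [h, map_incl]
    exact congrArg (incl hσ X X) hy₂

end ImageCategory

end IsFunctorialSection

/-- **Compatibility of functorial sections with radicial functors.** Given a radicial
additive `K`-linear functor `T : B ⥤ C` between small Wedderburn `K`-linear categories and
functorial `K`-linear sections `σC`, `σB` for `C` and `B`, there is a family of
automorphisms `u X : T.obj X ≅ T.obj X` with `(u X).hom - 𝟙` in the radical such that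
`σC (T h) = (u X)⁻¹ ≫ T (σB h) ≫ u X'` for every `h : X ⟶ X'`. -/
theorem sections_conjugate_along_radicial_functor
    (K : Type u) [Field K] (B C : Type v) [SmallCategory B] [SmallCategory C]
    [Preadditive B] [Preadditive C] [CategoryTheory.Linear K B] [CategoryTheory.Linear K C]
    [Limits.HasFiniteBiproducts B] [Limits.HasFiniteBiproducts C]
    (hWB : IsWedderburnCat K B) (hWC : IsWedderburnCat K C)
    (T : B ⥤ C) [T.Additive] [T.Linear K]
    (hT : ∀ (X Y : B) (f : X ⟶ Y), f ∈ catRadical X Y →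
      T.map f ∈ catRadical (T.obj X) (T.obj Y))
    (σC : ∀ X Y : C, (X ⟶ Y) →ₗ[K] (X ⟶ Y)) (hσC : IsFunctorialSection K σC)
    (σB : ∀ X Y : B, (X ⟶ Y) →ₗ[K] (X ⟶ Y)) (hσB : IsFunctorialSection K σB) :
    ∃ u : ∀ X : B, T.obj X ≅ T.obj X,
      (∀ X : B, (u X).hom - 𝟙 (T.obj X) ∈ catRadical (T.obj X) (T.obj X)) ∧
      ∀ (X X' : B) (h : X ⟶ X'),
        σC (T.obj X) (T.obj X') (T.map h) = (u X).inv ≫ T.map (σB X X' h) ≫ (u X').hom := by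
  let t : hσB.ImageCategory → C := fun X ↦ T.obj X.of
  let G (X Y : hσB.ImageCategory) : (X ⟶ Y) →ₗ[K] (t X ⟶ t Y) :=
    T.mapLinearMap K ∘ₗ IsFunctorialSection.ImageCategory.incl hσB X Y
  let F (X Y : hσB.ImageCategory) : (X ⟶ Y) →ₗ[K] (t X ⟶ t Y) := σC (t X) (t Y) ∘ₗ G X Y
  have hG1 (X : hσB.ImageCategory) : G X X (𝟙 X) = 𝟙 (t X) := T.map_id _
  have hG (X Y Z : hσB.ImageCategory) (f : X ⟶ Y) (g : Y ⟶ Z) :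
      G X Z (f ≫ g) = G X Y f ≫ G Y Z g := T.map_comp _ _
  obtain ⟨u, hu1, hu⟩ := exists_natural_of_congruent
    (IsFunctorialSection.ImageCategory.isSemisimpleRing_end hσB hWB)
    (IsFunctorialSection.ImageCategory.eq_zero_of_mem_catRadical hσB)
    (IsFunctorialSection.ImageCategory.hasSeparabilityElement hσB hWB)
    σC hσC.2.2.1 hσC.2.2.2 t F G
    (fun X ↦ (congrArg _ (hG1 X)).trans (hσC.2.2.1 _)) hG1
    (fun X Y Z f g ↦ (congrArg _ (hG X Y Z f g)).trans (hσC.2.2.2 _ _ _ _ _)) hG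
    (fun X Y f ↦ hσC.map_map _)
  have hiso (X : B) : IsIso (u ⟨X⟩) := hσC.isIso_of_map_eq_id (hu1 ⟨X⟩)
  refine ⟨fun X ↦ @asIso _ _ _ _ (u ⟨X⟩) (hiso X), fun X ↦ ?_, fun X X' h ↦ ?_⟩
  · rw [← hσC.map_eq_zero_iff, map_sub, hσC.2.2.1]
    exact sub_eq_zero.2 (hu1 ⟨X⟩)
  · have hF : F ⟨X⟩ ⟨X'⟩ (IsFunctorialSection.ImageCategory.proj hσB ⟨X⟩ ⟨X'⟩ h) =
        σC (T.obj X) (T.obj X') (T.map h) := by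
      refine hσC.2.1 _ _ _ _ ?_
      have := hT X X' _ (hσB.1 X X' h)
      rwa [T.map_sub] at this
    rw [← hF, Iso.eq_inv_comp]
    exact (hu ⟨X⟩ ⟨X'⟩ (IsFunctorialSection.ImageCategory.proj hσB ⟨X⟩ ⟨X'⟩ h)).symm
end
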